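/- Let 1 < p < ∞, m₀, m₁ ∈ ℕ, m₂ ∈ ℕ₀, 0 ≤ ℓ < d and a₀, a₁ ∈ ℝ. Suppose d/p ≤ m₀ + m₁, m₀ < d/p, m₁ < d/p and m₂ ≤ m₀ + m₁ − d/p, and set a₂ := a₀ + a₁ − d/p. Then there exists a constant c such that ‖u·v | 𝒦^{m₂}_{a₂,p}(ℝ^d,ℝ^ℓ_*)‖ ≤ c ‖u | 𝒦^{m₀}_{a₀,p}(ℝ^d,ℝ^ℓ_*)‖ · ‖v | 𝒦^{m₁}_{a₁,p}(ℝ^d,ℝ^ℓ_*)‖ holds for all u ∈ 𝒦^{m₀}_{a₀,p}(ℝ^d,ℝ^ℓ_*) and all v ∈ 𝒦^{m₁}_{a₁,p}(ℝ^d,ℝ^ℓ_*). -/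

import Mathlib

open MeasureTheory Metric Set Filter
open scoped Topology ENNReal NNReal

noncomputable section

/-- `d`-dimensional Euclidean space. -/
abbrev Ed (d : ℕ) : Type := EuclideanSpace ℝ (Fin d)

/-- The finite set of all multi-indices `α : Fin d → ℕ` with `|α| = ∑ i, α i ≤ m`. -/
def multiIdx (d m : ℕ) : Finset (Fin d → ℕ) :=
  (Fintype.piFinset fun _ : Fin d => Finset.range (m + 1)).filter fun α => ∑ i, α i ≤ m

/-- First-order partial derivative in the `i`-th coordinate direction. -/
def pderivI (d : ℕ) (i : Fin d) (f : Ed d → ℝ) : Ed d → ℝ :=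
  fun x => fderiv ℝ f x (EuclideanSpace.single i 1)

/-- Iterated partial derivative `∂^α`. -/
def pderivA (d : ℕ) (α : Fin d → ℕ) (f : Ed d → ℝ) : Ed d → ℝ :=
  ((List.finRange d).foldr (fun i g => (pderivI d i)^[α i] ∘ g) id) f

/-- Smooth compactly supported test functions with support inside `Ω`. -/
def IsTestFun (d : ℕ) (Ω : Set (Ed d)) (φ : Ed d → ℝ) : Prop :=
  ContDiff ℝ (⊤ : ℕ∞) φ ∧ HasCompactSupport φ ∧ tsupport φ ⊆ Ω

/-- `v` is the `α`-th weak (distributional) derivative of `u` on `Ω`. -/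
def HasWeakDerivOn (d : ℕ) (Ω : Set (Ed d)) (α : Fin d → ℕ) (u v : Ed d → ℝ) : Prop :=
  LocallyIntegrableOn u Ω volume ∧ LocallyIntegrableOn v Ω volume ∧
    ∀ φ : Ed d → ℝ, IsTestFun d Ω φ →
      ∫ x in Ω, u x * pderivA d α φ x = (-1 : ℝ) ^ (∑ i, α i) * ∫ x in Ω, v x * φ x

/-- `D` is a family of weak derivatives of `u` on `Ω` for all multi-indices of order `≤ m`. -/
def IsWeakDerivFamily (d : ℕ) (Ω : Set (Ed d)) (m : ℕ) (u : Ed d → ℝ)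
    (D : (Fin d → ℕ) → Ed d → ℝ) : Prop :=
  ∀ α ∈ multiIdx d m, HasWeakDerivOn d Ω α u (D α)

/-- `x ↦ (ρ(x)^(|α|-a) |v(x)|)^p`, the integrand in the Kondratiev norm. -/
def kIntegrand (d : ℕ) (ρ : Ed d → ℝ) (a p : ℝ) (α : Fin d → ℕ) (v : Ed d → ℝ) : Ed d → ℝ :=
  fun x => (ρ x ^ (((∑ i, α i : ℕ) : ℝ) - a) * |v x|) ^ p

/-- The Kondratiev norm computed from a family `D` of weak derivatives. -/
def KnormP (d : ℕ) (Ω : Set (Ed d)) (ρ : Ed d → ℝ) (m : ℕ) (a p : ℝ)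
    (D : (Fin d → ℕ) → Ed d → ℝ) : ℝ :=
  (∑ α ∈ multiIdx d m, ∫ x in Ω, kIntegrand d ρ a p α (D α) x) ^ (1 / p)

/-- `D` witnesses membership of `u` in the Kondratiev space `𝒦^m_{a,p}(Ω, M)`
    (with weight function `ρ`). -/
def KMemData (d : ℕ) (Ω : Set (Ed d)) (ρ : Ed d → ℝ) (m : ℕ) (a p : ℝ)
    (u : Ed d → ℝ) (D : (Fin d → ℕ) → Ed d → ℝ) : Prop :=
  IsWeakDerivFamily d Ω m u D ∧
    ∀ α ∈ multiIdx d m, IntegrableOn (kIntegrand d ρ a p α (D α)) Ω volume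

/-- Membership in the Kondratiev space `𝒦^m_{a,p}(Ω, M)` with weight `ρ`, `p < ∞`. -/
def MemK (d : ℕ) (Ω : Set (Ed d)) (ρ : Ed d → ℝ) (m : ℕ) (a p : ℝ) (u : Ed d → ℝ) : Prop :=
  ∃ D, KMemData d Ω ρ m a p u D

open Classical in
/-- The Kondratiev norm of `u` (computed from a choice of weak derivative family;
    it is a.e. independent of this choice). -/
def Knorm (d : ℕ) (Ω : Set (Ed d)) (ρ : Ed d → ℝ) (m : ℕ) (a p : ℝ) (u : Ed d → ℝ) : ℝ :=
  if h : MemK d Ω ρ m a p u then KnormP d Ω ρ m a p h.choose else 0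

/-- `x ↦ ρ(x)^(|α|-a) v(x)`, the function whose `L_∞` norm enters the norm for `p = ∞`. -/
def kIntegrandInf (d : ℕ) (ρ : Ed d → ℝ) (a : ℝ) (α : Fin d → ℕ) (v : Ed d → ℝ) : Ed d → ℝ :=
  fun x => ρ x ^ (((∑ i, α i : ℕ) : ℝ) - a) * v x

/-- `D` witnesses membership of `u` in `𝒦^m_{a,∞}(Ω, M)`. -/
def KMemDataInf (d : ℕ) (Ω : Set (Ed d)) (ρ : Ed d → ℝ) (m : ℕ) (a : ℝ)
    (u : Ed d → ℝ) (D : (Fin d → ℕ) → Ed d → ℝ) : Prop :=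
  IsWeakDerivFamily d Ω m u D ∧
    ∀ α ∈ multiIdx d m,
      eLpNorm (kIntegrandInf d ρ a α (D α)) ⊤ (volume.restrict Ω) < ⊤

/-- Membership in `𝒦^m_{a,∞}(Ω, M)`. -/
def MemKInf (d : ℕ) (Ω : Set (Ed d)) (ρ : Ed d → ℝ) (m : ℕ) (a : ℝ) (u : Ed d → ℝ) : Prop :=
  ∃ D, KMemDataInf d Ω ρ m a u D

/-- The `𝒦^m_{a,∞}` norm computed from a family `D` of weak derivatives. -/
def KnormInfP (d : ℕ) (Ω : Set (Ed d)) (ρ : Ed d → ℝ) (m : ℕ) (a : ℝ)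
    (D : (Fin d → ℕ) → Ed d → ℝ) : ℝ :=
  ∑ α ∈ multiIdx d m, (eLpNorm (kIntegrandInf d ρ a α (D α)) ⊤ (volume.restrict Ω)).toReal

open Classical in
/-- The `𝒦^m_{a,∞}(Ω, M)` norm of `u`. -/
def KnormInf (d : ℕ) (Ω : Set (Ed d)) (ρ : Ed d → ℝ) (m : ℕ) (a : ℝ) (u : Ed d → ℝ) : ℝ :=
  if h : MemKInf d Ω ρ m a u then KnormInfP d Ω ρ m a h.choose else 0

/-- The subspace `ℝ^ℓ_* = {x : x₁ = ⋯ = x_{d-ℓ} = 0}` of `ℝ^d`. -/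
def RStar (d ℓ : ℕ) : Set (Ed d) := {x | ∀ i : Fin d, (i : ℕ) < d - ℓ → x i = 0}

/-- The weight `ρ(x) = min(1, |x'|)` for the model case `(ℝ^d, ℝ^ℓ_*)`. -/
def rhoModel (d ℓ : ℕ) (x : Ed d) : ℝ :=
  min 1 (Real.sqrt (∑ i ∈ Finset.univ.filter (fun i : Fin d => (i : ℕ) < d - ℓ), (x i) ^ 2))

/-- The model domain `ℝ^d ∖ ℝ^ℓ_*`. -/
def ModelDomain (d ℓ : ℕ) : Set (Ed d) := (RStar d ℓ)ᶜ

/-- Membership in the model Kondratiev space `𝒦^m_{a,p}(ℝ^d, ℝ^ℓ_*)`, `p < ∞`. -/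
def MemKM (d ℓ m : ℕ) (a p : ℝ) (u : Ed d → ℝ) : Prop :=
  MemK d (ModelDomain d ℓ) (rhoModel d ℓ) m a p u

/-- The norm of the model Kondratiev space `𝒦^m_{a,p}(ℝ^d, ℝ^ℓ_*)`, `p < ∞`. -/
def KnormM (d ℓ m : ℕ) (a p : ℝ) (u : Ed d → ℝ) : ℝ :=
  Knorm d (ModelDomain d ℓ) (rhoModel d ℓ) m a p u

/-- Membership in the model Kondratiev space `𝒦^m_{a,∞}(ℝ^d, ℝ^ℓ_*)`. -/
def MemKMInf (d ℓ m : ℕ) (a : ℝ) (u : Ed d → ℝ) : Prop :=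
  MemKInf d (ModelDomain d ℓ) (rhoModel d ℓ) m a u

/-- The norm of the model Kondratiev space `𝒦^m_{a,∞}(ℝ^d, ℝ^ℓ_*)`. -/
def KnormMInf (d ℓ m : ℕ) (a : ℝ) (u : Ed d → ℝ) : ℝ :=
  KnormInf d (ModelDomain d ℓ) (rhoModel d ℓ) m a u

lemma smooth_pderivI {d : ℕ} (i : Fin d) {f : Ed d → ℝ} (hf : ContDiff ℝ (⊤ : ℕ∞) f) :
    ContDiff ℝ (⊤ : ℕ∞) (pderivI d i f) := by
  have h : ContDiff ℝ (⊤ : ℕ∞) (fderiv ℝ f) := hf.fderiv_right (by exact_mod_cast le_top)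
  exact h.clm_apply contDiff_const

lemma smooth_pderivI_iter {d : ℕ} (i : Fin d) (n : ℕ) {f : Ed d → ℝ}
    (hf : ContDiff ℝ (⊤ : ℕ∞) f) : ContDiff ℝ (⊤ : ℕ∞) ((pderivI d i)^[n] f) := by
  induction n with
  | zero => exact hf
  | succ n ih => rw [Function.iterate_succ_apply']; exact smooth_pderivI i ih

lemma pderivI_comm {d : ℕ} (i j : Fin d) {f : Ed d → ℝ} (hf : ContDiff ℝ (⊤ : ℕ∞) f) :
    pderivI d i (pderivI d j f) = pderivI d j (pderivI d i f) := by
  have h : ContDiff ℝ (⊤ : ℕ∞) (fderiv ℝ f) := hf.fderiv_right (by exact_mod_cast le_top)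
  have key : ∀ (a b : Fin d) (x : Ed d), pderivI d a (pderivI d b f) x
      = fderiv ℝ (fderiv ℝ f) x (EuclideanSpace.single a 1) (EuclideanSpace.single b 1) := by
    intro a b x
    have hd : DifferentiableAt ℝ (fderiv ℝ f) x := (h.differentiable (by simp)) x
    unfold pderivI
    rw [fderiv_clm_apply hd (differentiableAt_const _)]
    simp
  funext x
  rw [key, key]
  have hs : IsSymmSndFDerivAt ℝ f x := by
    apply (hf.contDiffAt).isSymmSndFDerivAt
    simp only [minSmoothness_of_isRCLikeNormedField]
    exact WithTop.coe_le_coe.mpr (le_top : (2 : ℕ∞) ≤ ⊤)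
  exact hs.eq _ _

lemma pderivI_iter_comm {d : ℕ} (i j : Fin d) (n : ℕ) {f : Ed d → ℝ}
    (hf : ContDiff ℝ (⊤ : ℕ∞) f) :
    (pderivI d i)^[n] (pderivI d j f) = pderivI d j ((pderivI d i)^[n] f) := by
  induction n with
  | zero => rfl
  | succ n ih =>
    rw [Function.iterate_succ_apply', ih, Function.iterate_succ_apply',
      pderivI_comm i j (smooth_pderivI_iter i n hf)]

/-- partial fold -/
def pfold (d : ℕ) (l : List (Fin d)) (α : Fin d → ℕ) (f : Ed d → ℝ) : Ed d → ℝ :=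
  (l.foldr (fun i g => (pderivI d i)^[α i] ∘ g) id) f

lemma pfold_cons {d : ℕ} (i : Fin d) (l : List (Fin d)) (α : Fin d → ℕ) (f : Ed d → ℝ) :
    pfold d (i :: l) α f = (pderivI d i)^[α i] (pfold d l α f) := rfl

lemma smooth_pfold {d : ℕ} (l : List (Fin d)) (α : Fin d → ℕ) {f : Ed d → ℝ}
    (hf : ContDiff ℝ (⊤ : ℕ∞) f) : ContDiff ℝ (⊤ : ℕ∞) (pfold d l α f) := by
  induction l with
  | nil => exact hf
  | cons i l ih => rw [pfold_cons]; exact smooth_pderivI_iter _ _ ih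

lemma pfold_comm {d : ℕ} (l : List (Fin d)) (α : Fin d → ℕ) (j : Fin d) {f : Ed d → ℝ}
    (hf : ContDiff ℝ (⊤ : ℕ∞) f) : pfold d l α (pderivI d j f) = pderivI d j (pfold d l α f) := by
  induction l with
  | nil => rfl
  | cons i l ih =>
    rw [pfold_cons, pfold_cons, ih, pderivI_iter_comm _ _ _ (smooth_pfold l α hf)]

lemma pfold_notMem {d : ℕ} (l : List (Fin d)) (α : Fin d → ℕ) (j : Fin d) (hj : j ∉ l)
    (f : Ed d → ℝ) : pfold d l (α + Pi.single j 1) f = pfold d l α f := by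
  induction l with
  | nil => rfl
  | cons i l ih =>
    simp only [List.mem_cons, not_or] at hj
    rw [pfold_cons, pfold_cons, ih hj.2]
    have : (α + Pi.single j 1 : Fin d → ℕ) i = α i := by
      simp [Ne.symm hj.1]
    rw [this]

lemma pfold_mem {d : ℕ} (l : List (Fin d)) (hl : l.Nodup) (α : Fin d → ℕ) (j : Fin d) (hj : j ∈ l)
    {f : Ed d → ℝ} (hf : ContDiff ℝ (⊤ : ℕ∞) f) :
    pfold d l (α + Pi.single j 1) f = pfold d l α (pderivI d j f) := by
  induction l with
  | nil => simp at hj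
  | cons i l ih =>
    rw [List.nodup_cons] at hl
    rw [pfold_cons, pfold_cons]
    by_cases hij : j = i
    · subst hij
      rw [pfold_notMem l α j hl.1 f]
      have : (α + Pi.single j 1 : Fin d → ℕ) j = α j + 1 := by simp
      rw [this, Function.iterate_succ_apply, pfold_comm l α j hf]
    · have hjl : j ∈ l := by simpa [hij] using hj
      rw [ih hl.2 hjl]
      have : (α + Pi.single j 1 : Fin d → ℕ) i = α i := by
        simp [Ne.symm hij]
      rw [this]

lemma pderivA_add_single {d : ℕ} (α : Fin d → ℕ) (j : Fin d) {f : Ed d → ℝ}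
    (hf : ContDiff ℝ (⊤ : ℕ∞) f) :
    pderivA d (α + Pi.single j 1) f = pderivA d α (pderivI d j f) :=
  pfold_mem (List.finRange d) (List.nodup_finRange d) α j (List.mem_finRange j) hf

lemma pderivA_zero {d : ℕ} (f : Ed d → ℝ) : pderivA d 0 f = f := by
  have : ∀ l : List (Fin d), pfold d l 0 f = f := by
    intro l
    induction l with
    | nil => rfl
    | cons i l ih => rw [pfold_cons, ih]; rfl
  exact this _

lemma pderivI_mul {d : ℕ} (i : Fin d) {f g : Ed d → ℝ} (hf : Differentiable ℝ f)
    (hg : Differentiable ℝ g) (x : Ed d) :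
    pderivI d i (fun y => f y * g y) x = f x * pderivI d i g x + pderivI d i f x * g x := by
  unfold pderivI
  rw [fderiv_fun_mul (hf x) (hg x)]
  simp; ring

lemma tsupport_pderivI {d : ℕ} (i : Fin d) (f : Ed d → ℝ) :
    tsupport (pderivI d i f) ⊆ tsupport f := by
  apply closure_minimal _ (isClosed_tsupport f)
  intro x hx
  by_contra h
  apply hx
  have : fderiv ℝ f x = 0 := by
    by_contra h'
    exact h (support_fderiv_subset ℝ h')
  simp [pderivI, this]

lemma IsTestFun.pderivI {d : ℕ} {Ω : Set (Ed d)} {φ : Ed d → ℝ} (h : IsTestFun d Ω φ) (i : Fin d) :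
    IsTestFun d Ω (pderivI d i φ) :=
  ⟨smooth_pderivI i h.1, h.2.1.of_isClosed_subset (isClosed_tsupport _) (tsupport_pderivI i φ),
    (tsupport_pderivI i φ).trans h.2.2⟩

lemma IsTestFun.mul_smooth {d : ℕ} {Ω : Set (Ed d)} {φ ψ : Ed d → ℝ} (h : IsTestFun d Ω φ)
    (hψ : ContDiff ℝ (⊤ : ℕ∞) ψ) : IsTestFun d Ω (fun x => φ x * ψ x) := by
  have hs : tsupport (fun x => φ x * ψ x) ⊆ tsupport φ := tsupport_mul_subset_left
  exact ⟨h.1.mul hψ, h.2.1.of_isClosed_subset (isClosed_tsupport _) hs, hs.trans h.2.2⟩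

lemma IsTestFun.zero_of_notMem {d : ℕ} {Ω : Set (Ed d)} {φ : Ed d → ℝ} (h : IsTestFun d Ω φ)
    {x : Ed d} (hx : x ∉ Ω) : φ x = 0 :=
  image_eq_zero_of_notMem_tsupport (fun h' => hx (h.2.2 h'))

lemma IsTestFun.mono {d : ℕ} {Ω Ω' : Set (Ed d)} {φ : Ed d → ℝ} (h : IsTestFun d Ω φ)
    (hs : Ω ⊆ Ω') : IsTestFun d Ω' φ := ⟨h.1, h.2.1, h.2.2.trans hs⟩

/-- locally integrable times test function is integrable -/
lemma IsTestFun.integrable_mul {d : ℕ} {Ω : Set (Ed d)} {φ f : Ed d → ℝ} (h : IsTestFun d Ω φ)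
    (hf : LocallyIntegrableOn f Ω volume) : Integrable (fun x => f x * φ x) := by
  have h1 : IntegrableOn f (tsupport φ) volume := hf.integrableOn_compact_subset h.2.2 h.2.1
  have h2 : IntegrableOn (fun x => f x * φ x) (tsupport φ) volume :=
    h1.mul_continuousOn h.1.continuous.continuousOn h.2.1
  rw [← integrableOn_iff_integrable_of_support_subset (s := tsupport φ)]
  · exact h2
  · intro x hx
    apply subset_tsupport
    intro h0
    apply hx
    simp [h0]

lemma setIntegral_test {d : ℕ} {Ω : Set (Ed d)} {φ : Ed d → ℝ} (h : IsTestFun d Ω φ)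
    (f : Ed d → ℝ) : ∫ x in Ω, f x * φ x = ∫ x, f x * φ x :=
  setIntegral_eq_integral_of_forall_compl_eq_zero (fun x hx => by simp [h.zero_of_notMem hx])

/-- first-order weak derivative -/
def WD1 (d : ℕ) (Ω : Set (Ed d)) (i : Fin d) (f g : Ed d → ℝ) : Prop :=
  LocallyIntegrableOn f Ω volume ∧ LocallyIntegrableOn g Ω volume ∧
    ∀ φ : Ed d → ℝ, IsTestFun d Ω φ → ∫ x, f x * pderivI d i φ x = - ∫ x, g x * φ x

lemma IsTestFun.pderivA {d : ℕ} {Ω : Set (Ed d)} {φ : Ed d → ℝ} (h : IsTestFun d Ω φ)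
    (α : Fin d → ℕ) : IsTestFun d Ω (pderivA d α φ) := by
  have key : ∀ l : List (Fin d), IsTestFun d Ω (pfold d l α φ) := by
    intro l
    induction l with
    | nil => exact h
    | cons i l ih =>
      rw [pfold_cons]
      generalize α i = n
      induction n with
      | zero => exact ih
      | succ n ih2 => rw [Function.iterate_succ_apply']; exact ih2.pderivI i
  exact key _

lemma sum_add_single {d : ℕ} (α : Fin d → ℕ) (i : Fin d) :
    ∑ j, (α + Pi.single i 1 : Fin d → ℕ) j = ∑ j, α j + 1 := by
  simp [Finset.sum_add_distrib]

lemma mem_multiIdx {d m : ℕ} {α : Fin d → ℕ} : α ∈ multiIdx d m ↔ ∑ i, α i ≤ m := by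
  unfold multiIdx
  simp only [Finset.mem_filter, Fintype.mem_piFinset, Finset.mem_range, and_iff_right_iff_imp]
  intro h i
  have := Finset.single_le_sum (f := α) (fun _ _ => Nat.zero_le _) (Finset.mem_univ i)
  omega

/-- pass from the weak derivatives of order `α` and `α + e_i` to a first order one. -/
lemma WD1_of_hasWeakDerivOn {d : ℕ} {Ω : Set (Ed d)} {α : Fin d → ℕ} {i : Fin d}
    {u f g : Ed d → ℝ} (h1 : HasWeakDerivOn d Ω α u f)
    (h2 : HasWeakDerivOn d Ω (α + Pi.single i 1) u g) : WD1 d Ω i f g := by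
  refine ⟨h1.2.1, h2.2.1, fun φ hφ => ?_⟩
  have e1 := h1.2.2 _ (hφ.pderivI i)
  have e2 := h2.2.2 _ hφ
  rw [pderivA_add_single α i hφ.1, sum_add_single, e1, setIntegral_test (hφ.pderivI i),
    setIntegral_test hφ, pow_succ] at e2
  have hne : ((-1 : ℝ) ^ (∑ i, α i)) ≠ 0 := by simp
  rw [mul_assoc] at e2
  have := mul_left_cancel₀ hne e2
  linarith

lemma hasWeakDerivOn_succ {d : ℕ} {Ω : Set (Ed d)} {α : Fin d → ℕ} {i : Fin d}
    {u f g : Ed d → ℝ} (h1 : HasWeakDerivOn d Ω α u f)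
    (h2 : WD1 d Ω i f g) : HasWeakDerivOn d Ω (α + Pi.single i 1) u g := by
  refine ⟨h1.1, h2.2.1, fun φ hφ => ?_⟩
  have e1 := h1.2.2 _ (hφ.pderivI i)
  have e2 := h2.2.2 _ hφ
  rw [pderivA_add_single α i hφ.1, sum_add_single, e1, setIntegral_test (hφ.pderivI i),
    setIntegral_test hφ, pow_succ, e2]
  ring

/-- uniqueness of weak derivatives -/
lemma weakDeriv_unique {d : ℕ} {Ω : Set (Ed d)} (hΩ : IsOpen Ω) {α : Fin d → ℕ}
    {u f g : Ed d → ℝ} (h1 : HasWeakDerivOn d Ω α u f) (h2 : HasWeakDerivOn d Ω α u g) :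
    ∀ᵐ x, x ∈ Ω → f x = g x := by
  have h := hΩ.ae_eq_zero_of_integral_contDiff_smul_eq_zero (μ := volume)
    (f := fun x => f x - g x) (h1.2.1.sub h2.2.1) (by
    intro φ hφ hc hs
    have ht : IsTestFun d Ω φ := ⟨hφ, hc, hs⟩
    have e1 := h1.2.2 _ ht
    have e2 := h2.2.2 _ ht
    rw [e1] at e2
    have hne : ((-1 : ℝ) ^ (∑ i, α i)) ≠ 0 := by simp
    have e3 := mul_left_cancel₀ hne e2
    rw [setIntegral_test ht, setIntegral_test ht] at e3
    have : ∀ x, φ x • (f x - g x) = f x * φ x - g x * φ x := by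
      intro x; simp; ring
    simp_rw [this]
    rw [integral_sub (ht.integrable_mul h1.2.1) (ht.integrable_mul h2.2.1), e3, sub_self])
  filter_upwards [h] with x hx hxΩ
  linarith [hx hxΩ]

/-- localization: a test function times a weakly differentiable function is weakly
differentiable on the whole space. -/
lemma WD1.localize {d : ℕ} {Ω : Set (Ed d)} {i : Fin d} {f g ψ : Ed d → ℝ}
    (h : WD1 d Ω i f g) (hψ : IsTestFun d Ω ψ) :
    Integrable (fun x => f x * ψ x) ∧
    Integrable (fun x => g x * ψ x + f x * pderivI d i ψ x) ∧
    ∀ φ : Ed d → ℝ, ContDiff ℝ (⊤ : ℕ∞) φ →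
      ∫ x, (f x * ψ x) * pderivI d i φ x
        = - ∫ x, (g x * ψ x + f x * pderivI d i ψ x) * φ x := by
  refine ⟨hψ.integrable_mul h.1, (hψ.integrable_mul h.2.1).add ((hψ.pderivI i).integrable_mul h.1),
    fun φ hφ => ?_⟩
  have ht : IsTestFun d Ω (fun x => ψ x * φ x) := hψ.mul_smooth hφ
  have e := h.2.2 _ ht
  have ht2 : IsTestFun d Ω (fun x => pderivI d i ψ x * φ x) := (hψ.pderivI i).mul_smooth hφ
  have ht3 : IsTestFun d Ω (fun x => ψ x * pderivI d i φ x) :=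
    hψ.mul_smooth (smooth_pderivI i hφ)
  have e1 : ∀ x, f x * pderivI d i (fun x => ψ x * φ x) x
      = f x * (ψ x * pderivI d i φ x) + f x * (pderivI d i ψ x * φ x) := by
    intro x
    rw [pderivI_mul i (hψ.1.differentiable (by simp)) (hφ.differentiable (by simp))]
    ring
  simp_rw [e1] at e
  rw [integral_add (ht3.integrable_mul h.1) (ht2.integrable_mul h.1)] at e
  have e2 : ∀ x, (g x * ψ x + f x * pderivI d i ψ x) * φ x
      = g x * (ψ x * φ x) + f x * (pderivI d i ψ x * φ x) := by intro x; ring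
  simp_rw [e2]
  rw [integral_add (ht.integrable_mul h.2.1) (ht2.integrable_mul h.1)]
  simp_rw [mul_assoc]
  linarith

open scoped Convolution in
/-- mollification with a bump function -/
def moll {d : ℕ} (φ : ContDiffBump (0 : Ed d)) (w : Ed d → ℝ) : Ed d → ℝ :=
  (φ.normed volume) ⋆[ContinuousLinearMap.lsmul ℝ ℝ, volume] w

lemma moll_apply {d : ℕ} (φ : ContDiffBump (0 : Ed d)) (w : Ed d → ℝ) (x : Ed d) :
    moll φ w x = ∫ t, φ.normed volume t * w (x - t) := rfl

lemma moll_apply' {d : ℕ} (φ : ContDiffBump (0 : Ed d)) (w : Ed d → ℝ) (x : Ed d) :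
    moll φ w x = ∫ t, φ.normed volume (x - t) * w t := by
  rw [moll_apply, ← integral_sub_left_eq_self _ volume x]
  simp

lemma moll_contDiff {d : ℕ} (φ : ContDiffBump (0 : Ed d)) {w : Ed d → ℝ}
    (hw : LocallyIntegrable w) : ContDiff ℝ (⊤ : ℕ∞) (moll φ w) :=
  φ.hasCompactSupport_normed.contDiff_convolution_left _ φ.contDiff_normed hw

lemma moll_pderivI {d : ℕ} (φ : ContDiffBump (0 : Ed d)) {w w' : Ed d → ℝ} (i : Fin d)
    (hw : LocallyIntegrable w)
    (h : ∀ φ : Ed d → ℝ, ContDiff ℝ (⊤ : ℕ∞) φ →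
      ∫ x, w x * pderivI d i φ x = - ∫ x, w' x * φ x) :
    pderivI d i (moll φ w) = moll φ w' := by
  funext x
  have hc : ContDiff ℝ (⊤ : ℕ∞) (φ.normed (volume : Measure (Ed d))) := φ.contDiff_normed
  have h1 := φ.hasCompactSupport_normed.hasFDerivAt_convolution_left
    (ContinuousLinearMap.lsmul ℝ ℝ) (μ := volume) (hc.of_le (by exact_mod_cast le_top)) hw x
  have h2 : pderivI d i (moll φ w) x
      = ∫ t, pderivI d i (φ.normed volume) t * w (x - t) := by
    unfold pderivI moll
    have hex := (φ.hasCompactSupport_normed.fderiv (𝕜 := ℝ)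
      (f := φ.normed (volume : Measure (Ed d)))).convolutionExists_left
      ((ContinuousLinearMap.lsmul ℝ ℝ : ℝ →L[ℝ] ℝ →L[ℝ] ℝ).precompL (Ed d)) (μ := volume)
      (hc.continuous_fderiv (by simp)) hw x
    rw [h1.fderiv]
    unfold MeasureTheory.convolution
    rw [ContinuousLinearMap.integral_apply hex]
    rfl
  rw [h2, moll_apply', ← integral_sub_left_eq_self _ volume x]
  have hsm : ContDiff ℝ (⊤ : ℕ∞) (fun t : Ed d => φ.normed volume (x - t)) :=
    hc.comp (contDiff_const.sub contDiff_id)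
  have h3 := h _ hsm
  have h4 : ∀ t, pderivI d i (fun t : Ed d => φ.normed volume (x - t)) t
      = - pderivI d i (φ.normed volume) (x - t) := by
    intro t
    unfold pderivI
    have hd : HasFDerivAt (φ.normed (volume : Measure (Ed d)))
        (fderiv ℝ (φ.normed (volume : Measure (Ed d))) (x - t)) (x - t) :=
      ((hc.differentiable (by simp)) (x - t)).hasFDerivAt
    have hs : HasFDerivAt (fun t : Ed d => x - t) (-(ContinuousLinearMap.id ℝ (Ed d))) t :=
      (hasFDerivAt_id t).const_sub x
    have := (hd.comp t hs).fderiv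
    change fderiv ℝ (φ.normed (volume : Measure (Ed d)) ∘ fun t => x - t) t _ = _
    rw [this]; simp
  simp_rw [h4] at h3
  simp only [mul_neg, integral_neg, neg_inj] at h3
  simp only [sub_sub_cancel]
  simp_rw [mul_comm _ (w _), mul_comm _ (w' _)]
  exact h3

lemma moll_contract {d : ℕ} (φ : ContDiffBump (0 : Ed d)) {w : Ed d → ℝ}
    (hw : AEStronglyMeasurable w) {p : ℝ≥0∞} (hp : 1 ≤ p) (hp' : p ≠ ⊤) :
    eLpNorm (moll φ w) p volume ≤ eLpNorm w p volume := by
  wlog hws : StronglyMeasurable w generalizing w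
  · have h1 := this hw.stronglyMeasurable_mk.aestronglyMeasurable hw.stronglyMeasurable_mk
    have h2 : moll φ w = moll φ (hw.mk w) := by
      funext x
      rw [moll_apply', moll_apply']
      apply integral_congr_ae
      filter_upwards [hw.ae_eq_mk] with t ht
      rw [ht]
    rw [h2]
    exact h1.trans_eq (eLpNorm_congr_ae hw.ae_eq_mk.symm)
  have hc : Continuous (φ.normed (volume : Measure (Ed d))) := φ.continuous_normed
  set ν : Measure (Ed d) := volume.withDensity (fun t => ENNReal.ofReal (φ.normed volume t)) with hν
  have hm : Measurable (fun t : Ed d => ENNReal.ofReal (φ.normed volume t)) :=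
    ENNReal.measurable_ofReal.comp hc.measurable
  have hνp : IsProbabilityMeasure ν := by
    constructor
    rw [hν, withDensity_apply _ MeasurableSet.univ, Measure.restrict_univ,
      ← ofReal_integral_eq_lintegral_ofReal φ.integrable_normed
        (Filter.Eventually.of_forall φ.nonneg_normed), φ.integral_normed, ENNReal.ofReal_one]
  have hp0 : p ≠ 0 := (zero_lt_one.trans_le hp).ne'
  have hpr : 0 < p.toReal := ENNReal.toReal_pos hp0 hp'
  have hpt : ∀ x, ‖moll φ w x‖ₑ ^ p.toReal ≤ ∫⁻ t, ‖w (x - t)‖ₑ ^ p.toReal ∂ν := by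
    intro x
    have hsm : StronglyMeasurable (fun t => w (x - t)) :=
      hws.comp_measurable (measurable_const.sub measurable_id)
    have e1 : ‖moll φ w x‖ₑ ≤ eLpNorm (fun t => w (x - t)) 1 ν := by
      rw [moll_apply, eLpNorm_one_eq_lintegral_enorm, hν,
        lintegral_withDensity_eq_lintegral_mul _ hm hsm.enorm]
      refine (enorm_integral_le_lintegral_enorm _).trans (lintegral_mono fun t => ?_)
      rw [enorm_mul, Real.enorm_of_nonneg (φ.nonneg_normed t)]
      rfl
    have e2 := e1.trans (eLpNorm_le_eLpNorm_of_exponent_le hp hsm.aestronglyMeasurable)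
    have e3 := ENNReal.rpow_le_rpow e2 hpr.le
    refine e3.trans_eq ?_
    rw [eLpNorm_eq_lintegral_rpow_enorm_toReal hp0 hp', ← ENNReal.rpow_mul,
      one_div, inv_mul_cancel₀ hpr.ne', ENNReal.rpow_one]
  rw [eLpNorm_eq_lintegral_rpow_enorm_toReal hp0 hp', eLpNorm_eq_lintegral_rpow_enorm_toReal hp0 hp']
  apply ENNReal.rpow_le_rpow _ (by positivity)
  calc ∫⁻ x, ‖moll φ w x‖ₑ ^ p.toReal ≤ ∫⁻ x, ∫⁻ t, ‖w (x - t)‖ₑ ^ p.toReal ∂ν :=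
        lintegral_mono hpt
    _ = ∫⁻ t, ∫⁻ x, ‖w (x - t)‖ₑ ^ p.toReal ∂volume ∂ν := by
        apply lintegral_lintegral_swap
        have : Measurable (fun q : Ed d × Ed d => ‖w (q.1 - q.2)‖ₑ ^ p.toReal) := by
          apply Measurable.pow_const
          exact (hws.comp_measurable (measurable_fst.sub measurable_snd)).enorm
        exact this.aemeasurable
    _ = ∫⁻ t, ∫⁻ x, ‖w x‖ₑ ^ p.toReal ∂volume ∂ν := by
        congr 1; funext t
        exact lintegral_sub_right_eq_self (fun x => ‖w x‖ₑ ^ p.toReal) t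
    _ = ∫⁻ x, ‖w x‖ₑ ^ p.toReal := by simp

lemma moll_support {d : ℕ} (φ : ContDiffBump (0 : Ed d)) {w : Ed d → ℝ} {K : Set (Ed d)}
    (hw : ∀ x ∉ K, w x = 0) {x : Ed d} (hx : x ∉ cthickening φ.rOut K) :
    moll φ w x = 0 := by
  rw [moll_apply']
  apply integral_eq_zero_of_ae
  refine Filter.Eventually.of_forall fun t => ?_
  by_cases ht : t ∈ K
  · have : φ.normed (volume : Measure (Ed d)) (x - t) = 0 := by
      by_contra h
      have hs : x - t ∈ Function.support (φ.normed (volume : Measure (Ed d))) := h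
      rw [φ.support_normed_eq, mem_ball_zero_iff] at hs
      apply hx
      apply mem_cthickening_of_dist_le x t _ _ ht
      rw [dist_eq_norm]; exact hs.le
    simp [this]
  · simp [hw t ht]

lemma moll_add {d : ℕ} (φ : ContDiffBump (0 : Ed d)) {w w' : Ed d → ℝ}
    (hw : LocallyIntegrable w) (hw' : LocallyIntegrable w') :
    moll φ (fun x => w x - w' x) = fun x => moll φ w x - moll φ w' x := by
  have hc : Continuous (φ.normed (volume : Measure (Ed d))) := φ.continuous_normed
  funext x
  have h1 := φ.hasCompactSupport_normed.convolutionExists_left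
    (ContinuousLinearMap.lsmul ℝ ℝ) (μ := volume) hc hw x
  have h2 := φ.hasCompactSupport_normed.convolutionExists_left
    (ContinuousLinearMap.lsmul ℝ ℝ) (μ := volume) hc hw' x
  rw [moll_apply, moll_apply, moll_apply]
  have h3 := integral_sub h1 h2
  simp only [ContinuousLinearMap.lsmul_apply, smul_eq_mul] at h3
  rw [← h3]
  simp only [mul_sub]

/-- the standard sequence of mollifiers -/
def bseq (d : ℕ) (n : ℕ) : ContDiffBump (0 : Ed d) :=
  ⟨1 / (2 * ((n : ℝ) + 1)), 1 / ((n : ℝ) + 1), by positivity, by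
    apply one_div_lt_one_div_of_lt <;> nlinarith [Nat.cast_nonneg (α := ℝ) n]⟩

lemma bseq_rOut (d n : ℕ) : (bseq d n).rOut = 1 / ((n : ℝ) + 1) := rfl

lemma bseq_tendsto (d : ℕ) : Tendsto (fun n => (bseq d n).rOut) atTop (𝓝 0) :=
  tendsto_one_div_add_atTop_nhds_zero_nat

lemma moll_ae_tendsto {d : ℕ} {w : Ed d → ℝ} (hw : LocallyIntegrable w) :
    ∀ᵐ x, Tendsto (fun n => moll (bseq d n) w x) atTop (𝓝 (w x)) := by
  apply ContDiffBump.ae_convolution_tendsto_right_of_locallyIntegrable (K := 2) (bseq_tendsto d) _ hw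
  refine Filter.Eventually.of_forall fun n => ?_
  change 1 / ((n : ℝ) + 1) ≤ 2 * (1 / (2 * ((n : ℝ) + 1)))
  apply le_of_eq
  field_simp

lemma moll_tendsto_of_cont {d : ℕ} {h : Ed d → ℝ} (hh : Continuous h) (hs : HasCompactSupport h)
    {p : ℝ≥0∞} (hp' : p ≠ ⊤) :
    Tendsto (fun n => eLpNorm (moll (bseq d n) h - h) p volume) atTop (𝓝 0) := by
  have huc : UniformContinuous h := hs.uniformContinuous_of_continuous hh
  set K := cthickening 1 (tsupport h) with hK
  have hKc : IsCompact K := hs.isCompact.cthickening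
  have hfin : volume K ^ (1 / p.toReal) ≠ ⊤ :=
    ENNReal.rpow_ne_top_of_nonneg (by positivity) hKc.measure_lt_top.ne
  rw [ENNReal.tendsto_atTop_zero]
  intro ε hε
  obtain ⟨δ, hδ, hδε⟩ : ∃ δ : ℝ, 0 < δ ∧ ENNReal.ofReal δ * volume K ^ (1 / p.toReal) ≤ ε := by
    have ht : Tendsto (fun δ : ℝ => ENNReal.ofReal δ * volume K ^ (1 / p.toReal)) (𝓝[>] 0)
        (𝓝 0) := by
      have h1 : Tendsto (fun δ : ℝ => ENNReal.ofReal δ) (𝓝[>] 0) (𝓝 0) := by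
        have := (ENNReal.continuous_ofReal.tendsto 0).mono_left (nhdsWithin_le_nhds (s := Ioi 0))
        simpa using this
      have := ENNReal.Tendsto.mul_const h1 (Or.inr hfin)
      simpa using this
    have h2 := (ht.eventually (Iic_mem_nhds hε)).and self_mem_nhdsWithin
    obtain ⟨δ, h3, h4⟩ := h2.exists
    exact ⟨δ, h4, h3⟩
  rw [Metric.uniformContinuous_iff] at huc
  obtain ⟨η, hη, hηδ⟩ := huc δ hδ
  have hev := (bseq_tendsto d).eventually (Iio_mem_nhds hη)
  obtain ⟨N, hN⟩ := Filter.eventually_atTop.1 hev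
  refine ⟨N, fun n hn => le_trans ?_ hδε⟩
  apply eLpNorm_sub_le_of_dist_bdd volume hp' hKc.measurableSet hδ.le
  · intro x
    apply ContDiffBump.dist_normed_convolution_le hh.aestronglyMeasurable
    intro y hy
    exact (hηδ (lt_trans hy (hN n hn))).le
  · intro x hx
    by_contra hxK
    apply hx
    apply moll_support (bseq d n) (K := tsupport h)
      (fun x hx => image_eq_zero_of_notMem_tsupport hx)
    intro hx2
    apply hxK
    refine cthickening_mono ?_ _ hx2
    rw [bseq_rOut, div_le_one (by positivity)]
    linarith [Nat.cast_nonneg (α := ℝ) n]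
  · exact (subset_tsupport h).trans (self_subset_cthickening _)

lemma moll_tendsto {d : ℕ} {w : Ed d → ℝ} {p : ℝ≥0∞} (hp : 1 ≤ p) (hp' : p ≠ ⊤)
    (hw : MemLp w p volume) :
    Tendsto (fun n => eLpNorm (moll (bseq d n) w - w) p volume) atTop (𝓝 0) := by
  rw [ENNReal.tendsto_atTop_zero]
  intro ε hε
  wlog hεt : ε ≠ ⊤ generalizing ε
  · simp only [ne_eq, not_not] at hεt
    subst hεt
    exact ⟨0, fun _ _ => le_top⟩
  have hε3 : 0 < (ε / 3).toReal := ENNReal.toReal_pos (by simpa using hε.ne')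
    (ENNReal.div_ne_top hεt (by simp))
  obtain ⟨h, hs, hh, hle⟩ := hw.exist_eLpNorm_sub_le hp' hp hε3
  rw [ENNReal.ofReal_toReal (ENNReal.div_ne_top hεt (by simp))] at hle
  have hhm : MemLp h p volume := hh.continuous.memLp_of_hasCompactSupport hs
  have ht := moll_tendsto_of_cont (d := d) hh.continuous hs hp'
  rw [ENNReal.tendsto_atTop_zero] at ht
  obtain ⟨N, hN⟩ := ht (ε / 3) (ENNReal.div_pos hε.ne' (by simp))
  refine ⟨N, fun n hn => ?_⟩
  have hwl : LocallyIntegrable w := hw.locallyIntegrable hp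
  have hhl : LocallyIntegrable h := hhm.locallyIntegrable hp
  have e : moll (bseq d n) w - w
      = (moll (bseq d n) (fun x => w x - h x) + (moll (bseq d n) h - h)) - (w - h) := by
    rw [moll_add _ hwl hhl]
    funext x
    simp
  have m1 : AEStronglyMeasurable (moll (bseq d n) (fun x => w x - h x)) volume :=
    (moll_contDiff _ (hwl.sub hhl)).continuous.aestronglyMeasurable
  have m2 : AEStronglyMeasurable (moll (bseq d n) h) volume :=
    (moll_contDiff _ hhl).continuous.aestronglyMeasurable
  have m3 : AEStronglyMeasurable (moll (bseq d n) h - h) volume := m2.sub hhm.1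
  calc eLpNorm (moll (bseq d n) w - w) p volume
      ≤ eLpNorm (moll (bseq d n) (fun x => w x - h x) + (moll (bseq d n) h - h)) p volume
        + eLpNorm (w - h) p volume := by
          rw [e]; exact eLpNorm_sub_le (m1.add m3) (hw.1.sub hhm.1) hp
    _ ≤ (eLpNorm (moll (bseq d n) (fun x => w x - h x)) p volume
        + eLpNorm (moll (bseq d n) h - h) p volume) + eLpNorm (w - h) p volume := by
          gcongr; exact eLpNorm_add_le m1 m3 hp
    _ ≤ (ε / 3 + ε / 3) + ε / 3 := by
          gcongr
          · exact (moll_contract _ (hw.1.sub hhm.1) hp hp').trans hle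
          · exact hN n hn
    _ = ε := ENNReal.add_thirds ε

/-- sum of squares of the coordinates in `A` -/
def sqA {d : ℕ} (A : Finset (Fin d)) (x : Ed d) : ℝ := ∑ i ∈ A, (x i) ^ 2

/-- the index set of the `x'` variables -/
def idxA (d ℓ : ℕ) : Finset (Fin d) := Finset.univ.filter (fun i : Fin d => (i : ℕ) < d - ℓ)

lemma sqA_nonneg {d : ℕ} (A : Finset (Fin d)) (x : Ed d) : 0 ≤ sqA A x :=
  Finset.sum_nonneg fun _ _ => sq_nonneg _

lemma sqA_contDiff {d : ℕ} (A : Finset (Fin d)) : ContDiff ℝ (⊤ : ℕ∞) (sqA A) := by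
  unfold sqA
  apply ContDiff.sum
  intro i _
  apply ContDiff.pow
  exact (EuclideanSpace.proj i : Ed d →L[ℝ] ℝ).contDiff

lemma rhoModel_eq (d ℓ : ℕ) (x : Ed d) : rhoModel d ℓ x = min 1 (Real.sqrt (sqA (idxA d ℓ) x)) := rfl

lemma mem_ModelDomain {d ℓ : ℕ} {x : Ed d} : x ∈ ModelDomain d ℓ ↔ 0 < sqA (idxA d ℓ) x := by
  unfold ModelDomain RStar sqA idxA
  rw [Finset.sum_pos_iff_of_nonneg (fun _ _ => sq_nonneg _)]
  simp [sq_pos_iff]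

lemma isOpen_ModelDomain (d ℓ : ℕ) : IsOpen (ModelDomain d ℓ) := by
  have : ModelDomain d ℓ = {x | 0 < sqA (idxA d ℓ) x} := by
    ext x; exact mem_ModelDomain
  rw [this]
  exact isOpen_lt continuous_const (sqA_contDiff _).continuous

lemma ae_mem_ModelDomain {d ℓ : ℕ} (hl : ℓ < d) : ∀ᵐ x : Ed d, x ∈ ModelDomain d ℓ := by
  rw [ae_iff]
  set i0 : Fin d := ⟨0, by omega⟩
  let S : Submodule ℝ (Ed d) := LinearMap.ker (EuclideanSpace.proj i0 : Ed d →L[ℝ] ℝ).toLinearMap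
  have hS : volume (S : Set (Ed d)) = 0 := by
    apply Measure.addHaar_submodule
    intro h
    have : (EuclideanSpace.single i0 (1 : ℝ) : Ed d) ∈ S := by rw [h]; trivial
    simp [S] at this
  refine measure_mono_null ?_ hS
  intro x hx
  simp only [ModelDomain, mem_setOf_eq, mem_compl_iff, not_not] at hx
  have := hx i0 (by simp [i0]; omega)
  simpa [S] using this

lemma restrict_ModelDomain {d ℓ : ℕ} (hl : ℓ < d) :
    (volume : Measure (Ed d)).restrict (ModelDomain d ℓ) = volume :=
  Measure.restrict_eq_self_of_ae_mem (ae_mem_ModelDomain hl)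

lemma rho_pos {d ℓ : ℕ} {x : Ed d} (hx : x ∈ ModelDomain d ℓ) : 0 < rhoModel d ℓ x := by
  rw [rhoModel_eq]
  exact lt_min one_pos (Real.sqrt_pos.2 (mem_ModelDomain.1 hx))

lemma rho_nonneg {d ℓ : ℕ} (x : Ed d) : 0 ≤ rhoModel d ℓ x := by
  rw [rhoModel_eq]
  exact le_min zero_le_one (Real.sqrt_nonneg _)

lemma rho_le_one {d ℓ : ℕ} (x : Ed d) : rhoModel d ℓ x ≤ 1 := by
  rw [rhoModel_eq]; exact min_le_left _ _

lemma rho_continuous (d ℓ : ℕ) : Continuous (rhoModel d ℓ) := by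
  have : rhoModel d ℓ = fun x => min 1 (Real.sqrt (sqA (idxA d ℓ) x)) := rfl
  rw [this]
  exact continuous_const.min (sqA_contDiff _).continuous.sqrt

/-- bounded logarithmic derivative in direction `e` -/
def LD {d : ℕ} (e : Ed d) (B : ℝ) (f : Ed d → ℝ) (x : Ed d) : Prop :=
  0 < f x ∧ ∃ f' : Ed d →L[ℝ] ℝ, HasFDerivAt f f' x ∧ |f' e| ≤ B * f x

lemma LD.mul {d : ℕ} {e : Ed d} {B B' : ℝ} {f g : Ed d → ℝ} {x : Ed d} (hf : LD e B f x)
    (hg : LD e B' g x) : LD e (B + B') (fun y => f y * g y) x := by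
  obtain ⟨f0, f', h1, h2⟩ := hf
  obtain ⟨g0, g', h3, h4⟩ := hg
  refine ⟨mul_pos f0 g0, _, h1.mul h3, ?_⟩
  simp only [ContinuousLinearMap.add_apply, ContinuousLinearMap.smul_apply, smul_eq_mul]
  calc |f x * g' e + g x * f' e| ≤ |f x * g' e| + |g x * f' e| := abs_add_le _ _
    _ = f x * |g' e| + g x * |f' e| := by rw [abs_mul, abs_mul, abs_of_pos f0, abs_of_pos g0]
    _ ≤ f x * (B' * g x) + g x * (B * f x) := by gcongr
    _ = _ := by ring

lemma LD.rpow {d : ℕ} {e : Ed d} {B : ℝ} {f : Ed d → ℝ} {x : Ed d} (hf : LD e B f x)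
    (r : ℝ) : LD e (|r| * B) (fun y => f y ^ r) x := by
  obtain ⟨f0, f', h1, h2⟩ := hf
  have h3 := (Real.hasDerivAt_rpow_const (x := f x) (p := r) (Or.inl f0.ne')).comp_hasFDerivAt x h1
  refine ⟨Real.rpow_pos_of_pos f0 r, _, h3, ?_⟩
  simp only [ContinuousLinearMap.smul_apply, smul_eq_mul]
  have hpos : 0 < f x ^ (r - 1) := Real.rpow_pos_of_pos f0 _
  rw [abs_mul, abs_mul, abs_of_pos hpos]
  calc |r| * f x ^ (r - 1) * |f' e| ≤ |r| * f x ^ (r - 1) * (B * f x) := by gcongr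
    _ = |r| * B * (f x ^ (r - 1) * f x) := by ring
    _ = |r| * B * f x ^ r := by
      congr 1
      rw [Real.rpow_sub_one f0.ne', div_mul_cancel₀ _ f0.ne']

lemma LD.mono {d : ℕ} {e : Ed d} {B B' : ℝ} {f : Ed d → ℝ} {x : Ed d} (hf : LD e B f x)
    (h : B ≤ B') : LD e B' f x := by
  obtain ⟨f0, f', h1, h2⟩ := hf
  exact ⟨f0, f', h1, h2.trans (by gcongr)⟩

lemma sqA_deriv {d : ℕ} (A : Finset (Fin d)) (i : Fin d) (x : Ed d) :
    ∃ f' : Ed d →L[ℝ] ℝ, HasFDerivAt (sqA A) f' x ∧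
      |f' (EuclideanSpace.single i 1)| ≤ 2 * Real.sqrt (sqA A x) := by
  have h1 : ∀ j ∈ A, HasFDerivAt (fun y : Ed d => (y j) ^ 2)
      ((2 * x j) • (EuclideanSpace.proj j : Ed d →L[ℝ] ℝ)) x := by
    intro j _
    have := ((EuclideanSpace.proj j : Ed d →L[ℝ] ℝ).hasFDerivAt (x := x)).pow 2
    simpa using this
  have h2 := HasFDerivAt.fun_sum h1
  refine ⟨_, h2, ?_⟩
  have e : (∑ j ∈ A, (2 * x j) • (EuclideanSpace.proj j : Ed d →L[ℝ] ℝ))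
      (EuclideanSpace.single i 1) = if i ∈ A then 2 * x i else 0 := by
    simp [ContinuousLinearMap.sum_apply]
  rw [e]
  split_ifs with hi
  · rw [abs_mul, abs_two]
    gcongr
    apply Real.abs_le_sqrt
    exact Finset.single_le_sum (f := fun j => (x j) ^ 2) (fun _ _ => sq_nonneg _) hi
  · simp

lemma LD_sqA {d : ℕ} (A : Finset (Fin d)) (i : Fin d) (x : Ed d) (hx : 0 < sqA A x) :
    LD (EuclideanSpace.single i 1) (2 / Real.sqrt (sqA A x)) (sqA A) x := by
  obtain ⟨f', h1, h2⟩ := sqA_deriv A i x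
  refine ⟨hx, f', h1, h2.trans_eq ?_⟩
  have hs := Real.sqrt_pos.2 hx
  have := Real.mul_self_sqrt hx.le
  field_simp
  rw [sq, this]

lemma LD_one_add_sqA {d : ℕ} (A : Finset (Fin d)) (i : Fin d) (x : Ed d) :
    LD (EuclideanSpace.single i 1) 1 (fun y => 1 + sqA A y) x := by
  obtain ⟨f', h1, h2⟩ := sqA_deriv A i x
  have h0 := sqA_nonneg A x
  refine ⟨by linarith, f', h1.const_add 1, h2.trans ?_⟩
  have := Real.mul_self_sqrt h0
  nlinarith [sq_nonneg (Real.sqrt (sqA A x) - 1)]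

/-- smooth squared weight -/
def tW (d ℓ : ℕ) (x : Ed d) : ℝ := sqA (idxA d ℓ) x * (1 + sqA (idxA d ℓ) x) ^ (-1 : ℝ)

/-- cutoff variable -/
def tauW (d ℓ : ℕ) (x : Ed d) : ℝ := tW d ℓ x * (1 + sqA Finset.univ x) ^ (-1 : ℝ)

lemma inv_sqrt_le {d ℓ : ℕ} {x : Ed d} (hx : x ∈ ModelDomain d ℓ) :
    2 / Real.sqrt (sqA (idxA d ℓ) x) ≤ 2 / rhoModel d ℓ x := by
  have := rho_pos hx
  gcongr
  rw [rhoModel_eq]; exact min_le_right _ _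

lemma one_le_inv_rho {d ℓ : ℕ} {x : Ed d} (hx : x ∈ ModelDomain d ℓ) :
    1 ≤ 1 / rhoModel d ℓ x := by
  rw [le_div_iff₀ (rho_pos hx), one_mul]; exact rho_le_one x

lemma LD_tW {d ℓ : ℕ} (i : Fin d) {x : Ed d} (hx : x ∈ ModelDomain d ℓ) :
    LD (EuclideanSpace.single i 1) (3 / rhoModel d ℓ x) (tW d ℓ) x := by
  have h := (LD_sqA (idxA d ℓ) i x (mem_ModelDomain.1 hx)).mul
    ((LD_one_add_sqA (idxA d ℓ) i x).rpow (-1))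
  refine h.mono ?_
  have h1 := inv_sqrt_le hx
  have h2 := one_le_inv_rho hx
  have e : 3 / rhoModel d ℓ x = 2 / rhoModel d ℓ x + 1 / rhoModel d ℓ x := by ring
  rw [e]
  simp
  simp at h2
  linarith

lemma LD_tauW {d ℓ : ℕ} (i : Fin d) {x : Ed d} (hx : x ∈ ModelDomain d ℓ) :
    LD (EuclideanSpace.single i 1) (4 / rhoModel d ℓ x) (tauW d ℓ) x := by
  have h := (LD_tW i hx).mul ((LD_one_add_sqA Finset.univ i x).rpow (-1))
  refine h.mono ?_
  have h2 := one_le_inv_rho hx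
  have e : 4 / rhoModel d ℓ x = 3 / rhoModel d ℓ x + 1 / rhoModel d ℓ x := by ring
  rw [e]
  simp
  simp at h2
  linarith

lemma tW_eq {d ℓ : ℕ} (x : Ed d) :
    tW d ℓ x = sqA (idxA d ℓ) x / (1 + sqA (idxA d ℓ) x) := by
  rw [tW, Real.rpow_neg_one]; rfl

lemma tauW_eq {d ℓ : ℕ} (x : Ed d) :
    tauW d ℓ x = tW d ℓ x / (1 + sqA Finset.univ x) := by
  rw [tauW, Real.rpow_neg_one]; rfl

lemma tW_contDiff (d ℓ : ℕ) : ContDiff ℝ (⊤ : ℕ∞) (tW d ℓ) := by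
  have : tW d ℓ = fun x => sqA (idxA d ℓ) x / (1 + sqA (idxA d ℓ) x) := funext tW_eq
  rw [this]
  exact (sqA_contDiff _).div (contDiff_const.add (sqA_contDiff _))
    (fun x => by have := sqA_nonneg (idxA d ℓ) x; positivity)

lemma tauW_contDiff (d ℓ : ℕ) : ContDiff ℝ (⊤ : ℕ∞) (tauW d ℓ) := by
  have : tauW d ℓ = fun x => tW d ℓ x / (1 + sqA Finset.univ x) := funext tauW_eq
  rw [this]
  exact (tW_contDiff d ℓ).div (contDiff_const.add (sqA_contDiff _))
    (fun x => by have := sqA_nonneg Finset.univ x; positivity)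

lemma tW_le_one {d ℓ : ℕ} (x : Ed d) : tW d ℓ x ≤ 1 := by
  rw [tW_eq]
  have := sqA_nonneg (idxA d ℓ) x
  rw [div_le_one (by positivity)]; linarith

lemma tW_le_rho {d ℓ : ℕ} (x : Ed d) : tW d ℓ x ≤ rhoModel d ℓ x ^ 2 := by
  have h0 := sqA_nonneg (idxA d ℓ) x
  rw [rhoModel_eq]
  rcases min_cases 1 (Real.sqrt (sqA (idxA d ℓ) x)) with ⟨h, _⟩ | ⟨h, _⟩
  · rw [h]; simpa using tW_le_one x
  · rw [h, Real.sq_sqrt h0, tW_eq]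
    exact div_le_self h0 (by linarith)

lemma rho_le_tW {d ℓ : ℕ} (x : Ed d) : rhoModel d ℓ x ^ 2 ≤ 2 * tW d ℓ x := by
  have h0 := sqA_nonneg (idxA d ℓ) x
  have h1 : rhoModel d ℓ x ^ 2 ≤ 1 := by
    have := rho_le_one (ℓ := ℓ) x
    have := rho_nonneg (ℓ := ℓ) x
    nlinarith
  have h2 : rhoModel d ℓ x ^ 2 ≤ sqA (idxA d ℓ) x := by
    have h3 : rhoModel d ℓ x ≤ Real.sqrt (sqA (idxA d ℓ) x) := min_le_right _ _
    have := pow_le_pow_left₀ (rho_nonneg (ℓ := ℓ) x) h3 2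
    rwa [Real.sq_sqrt h0] at this
  rw [tW_eq, mul_div_assoc', le_div_iff₀ (by positivity)]
  nlinarith

lemma tW_pos {d ℓ : ℕ} {x : Ed d} (hx : x ∈ ModelDomain d ℓ) : 0 < tW d ℓ x := by
  rw [tW_eq]
  have := mem_ModelDomain.1 hx
  positivity

lemma tW_rpow_bounds {d ℓ : ℕ} (b : ℝ) {x : Ed d} (hx : x ∈ ModelDomain d ℓ) :
    tW d ℓ x ^ (b / 2) ≤ 2 ^ (|b| / 2) * rhoModel d ℓ x ^ b ∧
    rhoModel d ℓ x ^ b ≤ 2 ^ (|b| / 2) * tW d ℓ x ^ (b / 2) := by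
  have hr := rho_pos hx
  have ht := tW_pos hx
  have e : rhoModel d ℓ x ^ b = (rhoModel d ℓ x ^ 2) ^ (b / 2) := by
    rw [← Real.rpow_natCast, ← Real.rpow_mul hr.le]; congr 1; push_cast; ring
  rw [e]
  have h1 := tW_le_rho (ℓ := ℓ) x
  have h2 := rho_le_tW (ℓ := ℓ) x
  have hr2 : 0 < rhoModel d ℓ x ^ 2 := by positivity
  set r := rhoModel d ℓ x ^ 2
  set t := tW d ℓ x
  have hone : (1 : ℝ) ≤ 2 ^ (|b| / 2) := Real.one_le_rpow (by norm_num) (by positivity)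
  rcases le_total 0 b with hb | hb
  · have hb2 : 0 ≤ b / 2 := by linarith
    rw [abs_of_nonneg hb] at *
    constructor
    · have := Real.rpow_le_rpow ht.le h1 hb2
      have h3 : 0 ≤ r ^ (b / 2) := by positivity
      nlinarith
    · rw [← Real.mul_rpow (by norm_num) ht.le]
      exact Real.rpow_le_rpow hr2.le h2 hb2
  · have hb2 : b / 2 ≤ 0 := by linarith
    rw [abs_of_nonpos hb] at *
    constructor
    · have h4 : r / 2 ≤ t := by linarith
      have := Real.rpow_le_rpow_of_nonpos (by positivity) h4 hb2
      refine this.trans_eq ?_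
      rw [Real.div_rpow hr2.le (by norm_num), neg_div, Real.rpow_neg (by norm_num)]
      field_simp
    · have := Real.rpow_le_rpow_of_nonpos ht h1 hb2
      have h3 : 0 ≤ t ^ (b / 2) := by positivity
      nlinarith

/-- one variable cutoff, `0` for `y ≤ 1`, `1` for `y ≥ 2`. -/
def cutS (y : ℝ) : ℝ := Real.smoothTransition (y - 1)

lemma cutS_contDiff : ContDiff ℝ (⊤ : ℕ∞) cutS :=
  Real.smoothTransition.contDiff.comp (contDiff_id.sub contDiff_const)

lemma cutS_deriv_bound : ∃ M : ℝ, 0 ≤ M ∧ ∀ y, 0 ≤ y → |deriv cutS y| * y ≤ M := by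
  have hc : Continuous (fun y => |deriv cutS y| * y) :=
    ((cutS_contDiff.continuous_deriv (by simp)).abs).mul continuous_id
  obtain ⟨M, hM⟩ := (isCompact_Icc (a := (0 : ℝ)) (b := 3)).exists_bound_of_continuousOn
    hc.continuousOn
  refine ⟨max M 0, le_max_right _ _, fun y hy => ?_⟩
  by_cases h : y ≤ 3
  · exact (le_abs_self _).trans ((hM y ⟨hy, h⟩).trans (le_max_left _ _))
  · push Not at h
    have : cutS =ᶠ[𝓝 y] fun _ => 1 := by
      filter_upwards [Ioi_mem_nhds h] with z hz
      exact Real.smoothTransition.one_of_one_le (by simp at hz; linarith)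
    rw [this.deriv_eq]
    simp

/-- truncated weight -/
def psiW (d ℓ : ℕ) (b : ℝ) (n : ℕ) (x : Ed d) : ℝ :=
  tW d ℓ x ^ (b / 2) * cutS (n * tauW d ℓ x)

lemma psiW_zero {d ℓ : ℕ} {b : ℝ} {n : ℕ} {x : Ed d} (h : n * tauW d ℓ x ≤ 1) :
    psiW d ℓ b n x = 0 := by
  rw [psiW, cutS, Real.smoothTransition.zero_of_nonpos (by linarith), mul_zero]

lemma mem_of_tauW_pos {d ℓ : ℕ} {x : Ed d} (h : 0 < tauW d ℓ x) : x ∈ ModelDomain d ℓ := by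
  rw [mem_ModelDomain]
  by_contra hx
  have h0 : sqA (idxA d ℓ) x = 0 := le_antisymm (not_lt.1 hx) (sqA_nonneg _ _)
  rw [tauW_eq, tW_eq, h0] at h
  simp at h

lemma psiW_test (d ℓ : ℕ) (b : ℝ) (n : ℕ) : IsTestFun d (ModelDomain d ℓ) (psiW d ℓ b n) := by
  have hct := (tauW_contDiff d ℓ).continuous
  have hcl : IsClosed {x : Ed d | 1 ≤ n * tauW d ℓ x} :=
    isClosed_le continuous_const (continuous_const.mul hct)
  have hsub : tsupport (psiW d ℓ b n) ⊆ {x : Ed d | 1 ≤ n * tauW d ℓ x} := by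
    apply closure_minimal _ hcl
    intro x hx
    by_contra h
    simp only [mem_setOf_eq, not_le] at h
    exact hx (psiW_zero h.le)
  have hmem : ∀ x : Ed d, 1 ≤ n * tauW d ℓ x → x ∈ ModelDomain d ℓ := by
    intro x hx
    apply mem_of_tauW_pos
    by_contra h
    push Not at h
    have : (n : ℝ) * tauW d ℓ x ≤ 0 := mul_nonpos_of_nonneg_of_nonpos (Nat.cast_nonneg n) h
    linarith
  refine ⟨?_, ?_, fun x hx => hmem x (hsub hx)⟩
  · rw [contDiff_iff_contDiffAt]
    intro x
    by_cases hx : x ∈ ModelDomain d ℓ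
    · have h1 : ContDiffAt ℝ (⊤ : ℕ∞) (fun y => tW d ℓ y ^ (b / 2)) x :=
        (tW_contDiff d ℓ).contDiffAt.rpow_const_of_ne (tW_pos hx).ne'
      exact h1.mul (cutS_contDiff.comp (contDiff_const.mul (tauW_contDiff d ℓ))).contDiffAt
    · have hz : x ∈ {x : Ed d | 1 ≤ n * tauW d ℓ x}ᶜ := fun h => hx (hmem x h)
      have : psiW d ℓ b n =ᶠ[𝓝 x] fun _ => 0 := by
        filter_upwards [hcl.isOpen_compl.mem_nhds hz] with y hy
        simp only [mem_compl_iff, mem_setOf_eq, not_le] at hy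
        exact psiW_zero hy.le
      exact contDiffAt_const.congr_of_eventuallyEq this
  · apply HasCompactSupport.of_support_subset_isCompact (isCompact_closedBall (0 : Ed d) (n + 1))
    intro x hx
    have h1 : 1 ≤ n * tauW d ℓ x := hsub (subset_tsupport _ hx)
    have hN := sqA_nonneg Finset.univ x
    have h2 : tauW d ℓ x ≤ 1 / (1 + sqA Finset.univ x) := by
      rw [tauW_eq]; gcongr; exact tW_le_one x
    have h3 : 1 ≤ n * (1 / (1 + sqA Finset.univ x)) := h1.trans (by gcongr)
    rw [mul_one_div, le_div_iff₀ (by positivity)] at h3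
    rw [mem_closedBall_zero_iff, EuclideanSpace.norm_eq]
    apply Real.sqrt_le_iff.2
    refine ⟨by positivity, ?_⟩
    have : ∑ i, ‖x i‖ ^ 2 = sqA Finset.univ x := by simp [sqA]
    rw [this]
    have := Nat.cast_nonneg (α := ℝ) n
    nlinarith

lemma psiW_bounds (d ℓ : ℕ) (b : ℝ) : ∃ C : ℝ, 0 < C ∧
    (∀ n, ∀ x ∈ ModelDomain d ℓ, |psiW d ℓ b n x| ≤ C * rhoModel d ℓ x ^ b) ∧
    (∀ n, ∀ i, ∀ x ∈ ModelDomain d ℓ,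
      |pderivI d i (psiW d ℓ b n) x| ≤ C * rhoModel d ℓ x ^ (b - 1)) ∧
    (∀ x ∈ ModelDomain d ℓ, rhoModel d ℓ x ^ b ≤ C * tW d ℓ x ^ (b / 2)) := by
  obtain ⟨M, hM0, hM⟩ := cutS_deriv_bound
  set C0 : ℝ := 2 ^ (|b| / 2) with hC0
  have hC0p : 0 < C0 := by positivity
  have hcut : ∀ y, |cutS y| ≤ 1 := fun y => by
    rw [cutS, abs_of_nonneg (Real.smoothTransition.nonneg _)]
    exact Real.smoothTransition.le_one _
  refine ⟨C0 * (1 + 3 * |b / 2| + 4 * M), by positivity, ?_, ?_, ?_⟩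
  · intro n x hx
    have h1 := (tW_rpow_bounds b hx).1
    have ht : 0 < tW d ℓ x ^ (b / 2) := Real.rpow_pos_of_pos (tW_pos hx) _
    have hr : 0 < rhoModel d ℓ x ^ b := Real.rpow_pos_of_pos (rho_pos hx) _
    rw [psiW, abs_mul, abs_of_pos ht]
    calc tW d ℓ x ^ (b / 2) * |cutS (n * tauW d ℓ x)| ≤ (C0 * rhoModel d ℓ x ^ b) * 1 := by
          gcongr; exact hcut _
      _ ≤ (C0 * rhoModel d ℓ x ^ b) * (1 + 3 * |b / 2| + 4 * M) := by
          gcongr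
          have := abs_nonneg (b / 2)
          linarith
      _ = _ := by ring
  · intro n i x hx
    have h1 := (tW_rpow_bounds b hx).1
    obtain ⟨ht, f', hf1, hf2⟩ := (LD_tW i hx).rpow (b / 2)
    obtain ⟨hτ, g', hg1, hg2⟩ := LD_tauW i hx
    have hr := rho_pos hx
    have hrb : 0 < rhoModel d ℓ x ^ b := Real.rpow_pos_of_pos hr _
    have hcd : HasDerivAt cutS (deriv cutS (n * tauW d ℓ x)) (n * tauW d ℓ x) :=
      ((cutS_contDiff.differentiable (by simp)) _).hasDerivAt
    have hc := hcd.comp_hasFDerivAt x (hg1.const_mul (n : ℝ))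
    have hm := hf1.mul hc
    have e : pderivI d i (psiW d ℓ b n) x = _ :=
      congrArg (fun L : Ed d →L[ℝ] ℝ => L (EuclideanSpace.single i 1)) hm.fderiv
    rw [e]
    simp only [ContinuousLinearMap.add_apply, ContinuousLinearMap.smul_apply, smul_eq_mul,
      Function.comp]
    set e1 : Ed d := EuclideanSpace.single i 1
    set τ := tauW d ℓ x
    set t := tW d ℓ x ^ (b / 2)
    set r := rhoModel d ℓ x
    have hnτ : 0 ≤ (n : ℝ) * τ := by positivity
    have hb1 : |deriv cutS (n * τ) * (n * g' e1)| ≤ M * (4 / r) := by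
      rw [abs_mul, abs_mul, Nat.abs_cast]
      calc |deriv cutS (n * τ)| * (n * |g' e1|) ≤ |deriv cutS (n * τ)| * (n * (4 / r * τ)) := by
            gcongr
        _ = (|deriv cutS (n * τ)| * (n * τ)) * (4 / r) := by ring
        _ ≤ _ := by gcongr; exact hM _ hnτ
    calc |t * (deriv cutS (n * τ) * (n * g' e1)) + cutS (n * τ) * f' e1|
        ≤ |t * (deriv cutS (n * τ) * (n * g' e1))| + |cutS (n * τ) * f' e1| := abs_add_le _ _
      _ = t * |deriv cutS (n * τ) * (n * g' e1)| + |cutS (n * τ)| * |f' e1| := by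
          rw [abs_mul, abs_of_pos ht, abs_mul (cutS _)]
      _ ≤ t * (M * (4 / r)) + 1 * (|b / 2| * (3 / r) * t) := by
          gcongr; exact hcut _
      _ = t * ((3 * |b / 2| + 4 * M) / r) := by ring
      _ ≤ (C0 * r ^ b) * ((1 + 3 * |b / 2| + 4 * M) / r) := by
          gcongr; linarith
      _ = _ := by rw [Real.rpow_sub_one hr.ne']; ring
  · intro x hx
    have h1 := (tW_rpow_bounds b hx).2
    have ht : 0 < tW d ℓ x ^ (b / 2) := Real.rpow_pos_of_pos (tW_pos hx) _
    refine h1.trans ?_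
    calc (2:ℝ) ^ (|b| / 2) * tW d ℓ x ^ (b / 2) = C0 * tW d ℓ x ^ (b / 2) * 1 := by rw [mul_one]
      _ ≤ C0 * tW d ℓ x ^ (b / 2) * (1 + 3 * |b / 2| + 4 * M) := by
          gcongr
          have := abs_nonneg (b / 2)
          linarith
      _ = _ := by ring

lemma psiW_tendsto {d ℓ : ℕ} (b : ℝ) {x : Ed d} (hx : x ∈ ModelDomain d ℓ) :
    Tendsto (fun n => psiW d ℓ b n x) atTop (𝓝 (tW d ℓ x ^ (b / 2))) := by
  have hτ : 0 < tauW d ℓ x := by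
    rw [tauW_eq]
    have := tW_pos hx
    have := sqA_nonneg Finset.univ x
    positivity
  have h1 : Tendsto (fun n : ℕ => (n : ℝ) * tauW d ℓ x) atTop atTop :=
    tendsto_natCast_atTop_atTop.atTop_mul_const hτ
  apply tendsto_const_nhds.congr'
  filter_upwards [h1.eventually_ge_atTop 2] with n hn
  rw [psiW, cutS, Real.smoothTransition.one_of_one_le (by linarith), mul_one]

lemma fderiv_le_sum {d : ℕ} (u : Ed d → ℝ) (x : Ed d) :
    ‖fderiv ℝ u x‖ ≤ ∑ i, ‖pderivI d i u x‖ := by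
  apply ContinuousLinearMap.opNorm_le_bound _ (by positivity)
  intro y
  have hy : y = ∑ i, y i • (EuclideanSpace.single i (1:ℝ) : Ed d) := by
    ext j
    simp [Finset.sum_apply, Pi.single_apply]
  conv_lhs => rw [hy]
  rw [map_sum, Finset.sum_mul]
  refine (norm_sum_le _ _).trans (Finset.sum_le_sum fun i _ => ?_)
  rw [map_smul, norm_smul, mul_comm]
  gcongr
  · exact le_rfl
  · exact PiLp.norm_apply_le y i

lemma eLpNorm_fatou {d : ℕ} {f : ℕ → Ed d → ℝ} {g : Ed d → ℝ} {p : ℝ≥0∞} {B : ℝ≥0∞}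
    (hf : ∀ n, AEStronglyMeasurable (f n) volume) (hB : ∀ n, eLpNorm (f n) p volume ≤ B)
    (h : ∀ᵐ x, Tendsto (fun n => f n x) atTop (𝓝 (g x))) : eLpNorm g p volume ≤ B := by
  refine (Lp.eLpNorm_lim_le_liminf_eLpNorm hf g h).trans ?_
  calc liminf (fun n => eLpNorm (f n) p volume) atTop ≤ liminf (fun _ : ℕ => B) atTop :=
        liminf_le_liminf (Eventually.of_forall hB)
    _ = B := liminf_const _

/-- Sobolev inequality for compactly supported weakly differentiable functions -/
lemma sobolev_weak {d : ℕ} (hd : 0 < d) {p p' : ℝ≥0} (hp : 1 ≤ p)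
    (hp' : (p' : ℝ)⁻¹ = (p : ℝ)⁻¹ - (d : ℝ)⁻¹) : ∃ C : ℝ≥0, ∀ (w : Ed d → ℝ) (w' : Fin d → Ed d → ℝ)
      (K : Set (Ed d)), IsCompact K → (∀ x ∉ K, w x = 0) → Integrable w → (∀ i, Integrable (w' i)) →
      (∀ i, ∀ φ : Ed d → ℝ, ContDiff ℝ (⊤ : ℕ∞) φ →
        ∫ x, w x * pderivI d i φ x = - ∫ x, w' i x * φ x) →
      eLpNorm w p' volume ≤ C * ∑ i, eLpNorm (w' i) p volume := by
  refine ⟨SNormLESNormFDerivOfEqConst ℝ (volume : Measure (Ed d)) p, ?_⟩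
  intro w w' K hK hwK hw hw' hder
  have hp1 : (1 : ℝ≥0∞) ≤ p := by exact_mod_cast hp
  have hpt : (p : ℝ≥0∞) ≠ ⊤ := ENNReal.coe_ne_top
  have hsm : ∀ n, ContDiff ℝ (⊤ : ℕ∞) (moll (bseq d n) w) :=
    fun n => moll_contDiff _ hw.locallyIntegrable
  refine eLpNorm_fatou (f := fun n => moll (bseq d n) w)
    (fun n => (hsm n).continuous.aestronglyMeasurable) ?_ (moll_ae_tendsto hw.locallyIntegrable)
  intro n
  have hcs : HasCompactSupport (moll (bseq d n) w) := by
    apply HasCompactSupport.intro (hK.cthickening (r := (bseq d n).rOut))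
    intro x hx
    exact moll_support _ hwK hx
  refine (eLpNorm_le_eLpNorm_fderiv_of_eq volume ((hsm n).of_le (by exact_mod_cast le_top)) hcs hp
    (by simpa using hd) (by simpa using hp')).trans ?_
  gcongr
  calc eLpNorm (fderiv ℝ (moll (bseq d n) w)) p volume
      ≤ eLpNorm (fun x => ∑ i, ‖pderivI d i (moll (bseq d n) w) x‖) p volume := by
        apply eLpNorm_mono_real
        exact fun x => fderiv_le_sum _ x
    _ = eLpNorm (∑ i, fun x => ‖moll (bseq d n) (w' i) x‖) p volume := by
        congr 1
        funext x
        simp only [Finset.sum_apply]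
        refine Finset.sum_congr rfl fun i _ => ?_
        rw [moll_pderivI _ i hw.locallyIntegrable (hder i)]
    _ ≤ ∑ i, eLpNorm (fun x => ‖moll (bseq d n) (w' i) x‖) p volume := by
        apply eLpNorm_sum_le _ hp1
        intro i _
        exact (moll_contDiff _ (hw' i).locallyIntegrable).continuous.norm.aestronglyMeasurable
    _ ≤ _ := by
        refine Finset.sum_le_sum fun i _ => ?_
        rw [eLpNorm_norm]
        exact moll_contract _ (hw' i).aestronglyMeasurable hp1 hpt

/-- weighted function -/
def wt (d ℓ : ℕ) (b : ℝ) (f : Ed d → ℝ) : Ed d → ℝ := fun x => rhoModel d ℓ x ^ b * f x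

lemma measurable_rho_rpow (d ℓ : ℕ) (b : ℝ) : Measurable (fun x => rhoModel d ℓ x ^ b) :=
  (rho_continuous d ℓ).measurable.pow_const b

lemma wt_aesm {d ℓ : ℕ} (b : ℝ) {f : Ed d → ℝ} (hf : AEStronglyMeasurable f volume) :
    AEStronglyMeasurable (wt d ℓ b f) volume :=
  (measurable_rho_rpow d ℓ b).aestronglyMeasurable.mul hf

lemma locInt_aesm {d ℓ : ℕ} (hl : ℓ < d) {f : Ed d → ℝ}
    (hf : LocallyIntegrableOn f (ModelDomain d ℓ) volume) : AEStronglyMeasurable f volume := by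
  have := hf.aestronglyMeasurable
  rwa [restrict_ModelDomain hl] at this

lemma ofReal_mul_eLpNorm {d : ℕ} (C : ℝ) (hC : 0 ≤ C) (f : Ed d → ℝ) (p : ℝ≥0∞) :
    eLpNorm (fun x => C * f x) p volume = ENNReal.ofReal C * eLpNorm f p volume := by
  have := eLpNorm_const_smul C f p (volume : Measure (Ed d))
  rw [Real.enorm_eq_ofReal hC] at this
  exact this

/-- weighted Sobolev inequality -/
lemma sobolev_step {d ℓ : ℕ} (hl : ℓ < d) (b : ℝ) {p p' : ℝ≥0} (hp : 1 ≤ p)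
    (hp' : (p' : ℝ)⁻¹ = (p : ℝ)⁻¹ - (d : ℝ)⁻¹) : ∃ C : ℝ≥0, ∀ (f : Ed d → ℝ) (f' : Fin d → Ed d → ℝ),
      (∀ i, WD1 d (ModelDomain d ℓ) i f (f' i)) →
      eLpNorm (wt d ℓ b f) p' volume ≤
        C * (eLpNorm (wt d ℓ (b - 1) f) p volume + ∑ i, eLpNorm (wt d ℓ b (f' i)) p volume) := by
  obtain ⟨S, hS⟩ := sobolev_weak (by omega : 0 < d) hp hp'
  obtain ⟨C, hC0, hC1, hC2, hC3⟩ := psiW_bounds d ℓ b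
  have hp1 : (1 : ℝ≥0∞) ≤ p := by exact_mod_cast hp
  have hdpos : 0 < d := by omega
  refine ⟨C.toNNReal * (S * (C.toNNReal * (d + 1))), ?_⟩
  intro f f' hW
  have hae := ae_mem_ModelDomain hl
  have hf := locInt_aesm hl (hW ⟨0, hdpos⟩).1
  have hf' := fun i => locInt_aesm hl (hW i).2.1
  set A := eLpNorm (wt d ℓ (b - 1) f) p volume with hA
  set B := fun i => eLpNorm (wt d ℓ b (f' i)) p volume with hB
  have key : ∀ n, eLpNorm (fun x => f x * psiW d ℓ b n x) p' volume
      ≤ S * (C.toNNReal * (d + 1)) * (A + ∑ i, B i) := by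
    intro n
    have ht := psiW_test d ℓ b n
    have hloc := fun i => (hW i).localize ht
    refine (hS _ _ (tsupport (psiW d ℓ b n)) ht.2.1.isCompact ?_ (hloc ⟨0, hdpos⟩).1
      (fun i => (hloc i).2.1) (fun i => (hloc i).2.2)).trans ?_
    · intro x hx
      simp [image_eq_zero_of_notMem_tsupport hx]
    rw [mul_assoc]
    gcongr
    have e1 : ∀ i, eLpNorm (fun x => f' i x * psiW d ℓ b n x + f x * pderivI d i (psiW d ℓ b n) x)
        p volume ≤ C.toNNReal * (B i + A) := by
      intro i
      refine (eLpNorm_add_le (hf' i |>.mul ht.1.continuous.aestronglyMeasurable)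
        (hf.mul (ht.pderivI i).1.continuous.aestronglyMeasurable) hp1).trans ?_
      rw [mul_add]
      have hCe : ((C.toNNReal : ℝ≥0) : ℝ≥0∞) = ENNReal.ofReal C := rfl
      gcongr
      · rw [hCe, hB, ← ofReal_mul_eLpNorm C hC0.le]
        apply eLpNorm_mono_ae
        filter_upwards [hae] with x hx
        have := hC1 n x hx
        have hr := Real.rpow_nonneg (rho_nonneg (ℓ := ℓ) x) b
        simp only [wt, Pi.mul_apply, norm_mul, Real.norm_eq_abs, abs_of_pos hC0, abs_of_nonneg hr]
        calc |f' i x| * |psiW d ℓ b n x| ≤ |f' i x| * (C * rhoModel d ℓ x ^ b) := by gcongr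
          _ = _ := by ring
      · rw [hCe, hA, ← ofReal_mul_eLpNorm C hC0.le]
        apply eLpNorm_mono_ae
        filter_upwards [hae] with x hx
        have := hC2 n i x hx
        have hr := Real.rpow_nonneg (rho_nonneg (ℓ := ℓ) x) (b - 1)
        simp only [wt, Pi.mul_apply, norm_mul, Real.norm_eq_abs, abs_of_pos hC0, abs_of_nonneg hr]
        calc |f x| * |pderivI d i (psiW d ℓ b n) x| ≤ |f x| * (C * rhoModel d ℓ x ^ (b - 1)) := by
              gcongr
          _ = _ := by ring
    refine (Finset.sum_le_sum fun i _ => e1 i).trans ?_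
    rw [← Finset.mul_sum, mul_assoc]
    gcongr
    rw [Finset.sum_add_distrib]
    simp only [Finset.sum_const, Finset.card_univ, Fintype.card_fin, nsmul_eq_mul]
    calc ∑ i, B i + d * A ≤ (d + 1) * (∑ i, B i) + (d + 1) * A := by
          gcongr
          · exact le_mul_of_one_le_left zero_le (by simp)
          · exact le_self_add
      _ = _ := by ring
  have key2 := eLpNorm_fatou (g := fun x => f x * tW d ℓ x ^ (b / 2)) (fun n =>
    hf.mul (psiW_test d ℓ b n).1.continuous.aestronglyMeasurable) key (by
      filter_upwards [hae] with x hx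
      exact (psiW_tendsto b hx).const_mul (f x))
  have key3 : eLpNorm (wt d ℓ b f) p' volume ≤
      ENNReal.ofReal C * eLpNorm (fun x => f x * tW d ℓ x ^ (b / 2)) p' volume := by
    rw [← ofReal_mul_eLpNorm C hC0.le]
    apply eLpNorm_mono_ae
    filter_upwards [hae] with x hx
    have := hC3 x hx
    have hr := Real.rpow_nonneg (rho_nonneg (ℓ := ℓ) x) b
    have ht : 0 < tW d ℓ x ^ (b / 2) := Real.rpow_pos_of_pos (tW_pos hx) _
    simp only [wt, norm_mul, Real.norm_eq_abs, abs_of_pos hC0, abs_of_nonneg hr, abs_of_pos ht]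
    calc rhoModel d ℓ x ^ b * |f x| ≤ (C * tW d ℓ x ^ (b / 2)) * |f x| := by gcongr
      _ = _ := by ring
  refine key3.trans ?_
  push_cast
  rw [mul_assoc]
  gcongr
  exact le_rfl

/-- local `L^q` membership -/
def LLp (d : ℕ) (Ω : Set (Ed d)) (q : ℝ≥0∞) (f : Ed d → ℝ) : Prop :=
  ∀ K, IsCompact K → K ⊆ Ω → MemLp f q (volume.restrict K)

lemma LLp.mul {d : ℕ} {Ω : Set (Ed d)} {s s' p : ℝ≥0∞} (hp : 1 ≤ p) (hH : ENNReal.HolderTriple s s' p)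
    {f g : Ed d → ℝ} (hf : LLp d Ω s f) (hg : LLp d Ω s' g) {K : Set (Ed d)} (hK : IsCompact K)
    (hKΩ : K ⊆ Ω) : IntegrableOn (fun x => f x * g x) K volume := by
  have h1 : MemLp (fun x => f x * g x) p (volume.restrict K) := (hg K hK hKΩ).mul' (hf K hK hKΩ)
  haveI : IsFiniteMeasure ((volume : Measure (Ed d)).restrict K) :=
    ⟨by simpa using hK.measure_lt_top⟩
  exact memLp_one_iff_integrable.1 (h1.mono_exponent hp)

lemma LLp.mul_locInt {d : ℕ} {Ω : Set (Ed d)} (hΩ : IsOpen Ω) {s s' p : ℝ≥0∞} (hp : 1 ≤ p)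
    (hH : ENNReal.HolderTriple s s' p)
    {f g : Ed d → ℝ} (hf : LLp d Ω s f) (hg : LLp d Ω s' g) :
    LocallyIntegrableOn (fun x => f x * g x) Ω volume := by
  rw [locallyIntegrableOn_iff hΩ.isLocallyClosed]
  exact fun K hKΩ hK => hf.mul hp hH hg hK hKΩ

lemma LLp.mul_test {d : ℕ} {Ω : Set (Ed d)} {s : ℝ≥0∞} {f φ : Ed d → ℝ} (hf : LLp d Ω s f)
    (hφ : IsTestFun d Ω φ) : MemLp (fun x => f x * φ x) s volume := by
  have hm : MeasurableSet (tsupport φ) := (isClosed_tsupport φ).measurableSet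
  have e : (fun x => f x * φ x) = (tsupport φ).indicator (fun x => f x * φ x) := by
    symm
    rw [Set.indicator_eq_self]
    intro x hx
    by_contra h
    exact hx (by simp [image_eq_zero_of_notMem_tsupport h])
  rw [e, memLp_indicator_iff_restrict hm]
  have h1 := hf _ hφ.2.1.isCompact hφ.2.2
  obtain ⟨C, hC⟩ := hφ.1.continuous.bounded_above_of_compact_support hφ.2.1
  refine (h1.const_mul C).mono (h1.1.mul hφ.1.continuous.aestronglyMeasurable) ?_
  refine Eventually.of_forall fun x => ?_
  have h2 := hC x
  have h3 : 0 ≤ C := (norm_nonneg _).trans h2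
  rw [norm_mul, norm_mul, mul_comm, Real.norm_of_nonneg h3]
  gcongr

lemma holder_tendsto {d : ℕ} {K : Set (Ed d)} (hK : IsCompact K) {s s' p : ℝ≥0∞} (hp : 1 ≤ p)
    (hH : ENNReal.HolderTriple s s' p) {g : Ed d → ℝ} (hg : MemLp g s' (volume.restrict K))
    {h : Ed d → ℝ} {hn : ℕ → Ed d → ℝ} (hh : MemLp h s volume) (hhn : ∀ n, MemLp (hn n) s volume)
    (h0 : ∀ x ∉ K, h x = 0) (hn0 : ∀ᶠ n in atTop, ∀ x ∉ K, hn n x = 0)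
    (hlim : Tendsto (fun n => eLpNorm (hn n - h) s volume) atTop (𝓝 0)) :
    Tendsto (fun n => ∫ x, g x * hn n x) atTop (𝓝 (∫ x, g x * h x)) := by
  set μ := (volume : Measure (Ed d)).restrict K with hμ
  haveI : IsFiniteMeasure μ := ⟨by simpa [hμ] using hK.measure_lt_top⟩
  have e0 : ∫ x, g x * h x = ∫ x in K, g x * h x :=
    (setIntegral_eq_integral_of_forall_compl_eq_zero (fun x hx => by simp [h0 x hx])).symm
  have e1 : ∀ᶠ n in atTop, ∫ x in K, g x * hn n x = ∫ x, g x * hn n x := by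
    filter_upwards [hn0] with n h
    exact setIntegral_eq_integral_of_forall_compl_eq_zero (fun x hx => by simp [h x hx])
  rw [e0]
  refine Tendsto.congr' e1 ?_
  have hintL : ∀ k : Ed d → ℝ, MemLp k s volume → MemLp (fun x => g x * k x) p μ := by
    intro k hk
    have := hg.mul' (hk.restrict K) (r := p)
    simpa only [mul_comm] using this
  apply tendsto_integral_of_L1' _ (hintL h hh).1
    (Eventually.of_forall fun n => memLp_one_iff_integrable.1 ((hintL _ (hhn n)).mono_exponent hp))
  have hb : ∀ n, eLpNorm ((fun x => g x * hn n x) - fun x => g x * h x) 1 μ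
      ≤ eLpNorm (hn n - h) s volume * (eLpNorm g s' μ * μ Set.univ ^ (1 / (1 : ℝ≥0∞).toReal - 1 / p.toReal)) := by
    intro n
    have e : ((fun x => g x * hn n x) - fun x => g x * h x) = (hn n - h) • g := by
      funext x
      simp only [Pi.sub_apply, Pi.smul_apply', smul_eq_mul]; ring
    have hsub := (hhn n).sub hh
    rw [e]
    refine (eLpNorm_le_eLpNorm_mul_rpow_measure_univ hp
      ((hsub.1.restrict).smul hg.1)).trans ?_
    rw [← mul_assoc]
    gcongr
    refine (eLpNorm_smul_le_mul_eLpNorm hg.1 hsub.1.restrict (p := s) (q := s')).trans ?_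
    gcongr
    exact Measure.restrict_le_self
  have hc : eLpNorm g s' μ * μ Set.univ ^ (1 / (1 : ℝ≥0∞).toReal - 1 / p.toReal) ≠ ⊤ := by
    apply ENNReal.mul_ne_top hg.2.ne
    apply ENNReal.rpow_ne_top_of_nonneg _ (measure_ne_top _ _)
    rcases eq_or_ne p ⊤ with rfl | hpt
    · simp
    have : 1 ≤ p.toReal := by
      rw [← ENNReal.toReal_one]
      exact (ENNReal.toReal_le_toReal (by simp) hpt).2 hp
    simp only [ENNReal.toReal_one, div_one, one_div, sub_nonneg]
    exact inv_le_one_of_one_le₀ this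
  refine tendsto_of_tendsto_of_tendsto_of_le_of_le tendsto_const_nhds ?_ (fun _ => zero_le) hb
  have := ENNReal.Tendsto.mul_const hlim (b := eLpNorm g s' μ * μ Set.univ ^ (1 / (1 : ℝ≥0∞).toReal - 1 / p.toReal)) (Or.inr hc)
  simpa using this

/-- product rule for weak derivatives -/
lemma WD1.mul {d : ℕ} {Ω : Set (Ed d)} (hΩ : IsOpen Ω) {i : Fin d} {f f' g g' : Ed d → ℝ}
    (hf : WD1 d Ω i f f') (hg : WD1 d Ω i g g') {s s' r r' p : ℝ≥0∞} (hp : 1 ≤ p)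
    (hs : 1 ≤ s) (hst : s ≠ ⊤) (hr : 1 ≤ r) (hrt : r ≠ ⊤)
    (hH : ENNReal.HolderTriple s s' p) (hH' : ENNReal.HolderTriple r r' p)
    (h1 : LLp d Ω s f) (h2 : LLp d Ω s f') (h3 : LLp d Ω s' g) (h4 : LLp d Ω r f)
    (h5 : LLp d Ω r' g') :
    WD1 d Ω i (fun x => f x * g x) (fun x => f' x * g x + f x * g' x) := by
  have L1 := LLp.mul_locInt hΩ hp hH h1 h3
  have L2 := LLp.mul_locInt hΩ hp hH h2 h3
  have L3 := LLp.mul_locInt hΩ hp hH' h4 h5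
  refine ⟨L1, L2.add L3, fun φ hφ => ?_⟩
  obtain ⟨l1, l2, l3⟩ := hf.localize hφ
  set w : Ed d → ℝ := fun x => f x * φ x with hw
  set w' : Ed d → ℝ := fun x => f' x * φ x + f x * pderivI d i φ x with hw'
  obtain ⟨δ, hδ, hδΩ⟩ := hφ.2.1.isCompact.exists_cthickening_subset_open hΩ hφ.2.2
  set K := cthickening δ (tsupport φ) with hKdef
  have hKc : IsCompact K := hφ.2.1.isCompact.cthickening
  have hφK : tsupport φ ⊆ K := self_subset_cthickening _
  have hw0 : ∀ x ∉ tsupport φ, w x = 0 := fun x hx => by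
    simp [hw, image_eq_zero_of_notMem_tsupport hx]
  have hw'0 : ∀ x ∉ tsupport φ, w' x = 0 := fun x hx => by
    have : x ∉ tsupport (pderivI d i φ) := fun h => hx (tsupport_pderivI i φ h)
    simp [hw', image_eq_zero_of_notMem_tsupport hx, image_eq_zero_of_notMem_tsupport this]
  have hev : ∀ᶠ n in atTop, (bseq d n).rOut ≤ δ :=
    (bseq_tendsto d).eventually_le_const hδ
  have hm : ∀ n, (bseq d n).rOut ≤ δ → ∀ u : Ed d → ℝ, (∀ x ∉ tsupport φ, u x = 0) →
      ∀ x ∉ K, moll (bseq d n) u x = 0 := by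
    intro n hn u hu x hx
    exact moll_support _ hu (fun h => hx (cthickening_mono hn _ h))
  have mw : MemLp w r volume := h4.mul_test hφ
  have mw' : MemLp w' s volume := (h2.mul_test hφ).add (h1.mul_test (hφ.pderivI i))
  have T1 := holder_tendsto hKc hp hH (h3 K hKc hδΩ) (h := w') (hn := fun n => moll (bseq d n) w')
    mw' (fun n => ⟨(moll_contDiff _ l2.locallyIntegrable).continuous.aestronglyMeasurable,
      (moll_contract _ mw'.1 hs hst).trans_lt mw'.2⟩) (fun x hx => hw'0 x (fun h => hx (hφK h)))
    (hev.mono fun n hn => hm n hn _ hw'0) (moll_tendsto hs hst mw')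
  have T2 := holder_tendsto hKc hp hH' (h5 K hKc hδΩ) (h := w) (hn := fun n => moll (bseq d n) w)
    mw (fun n => ⟨(moll_contDiff _ l1.locallyIntegrable).continuous.aestronglyMeasurable,
      (moll_contract _ mw.1 hr hrt).trans_lt mw.2⟩) (fun x hx => hw0 x (fun h => hx (hφK h)))
    (hev.mono fun n hn => hm n hn _ hw0) (moll_tendsto hr hrt mw)
  have heq : ∀ᶠ n in atTop, ∫ x, g x * moll (bseq d n) w' x = -∫ x, g' x * moll (bseq d n) w x := by
    filter_upwards [hev] with n hn
    have ht : IsTestFun d Ω (moll (bseq d n) w) := by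
      refine ⟨moll_contDiff _ l1.locallyIntegrable, HasCompactSupport.intro hKc (hm n hn _ hw0), ?_⟩
      refine (closure_minimal ?_ hKc.isClosed).trans hδΩ
      intro x hx
      by_contra h
      exact hx (hm n hn _ hw0 x h)
    rw [← hg.2.2 _ ht, moll_pderivI _ i l1.locallyIntegrable l3]
  have hlim := tendsto_nhds_unique (T1.congr' heq) T2.neg
  have I1 := hφ.integrable_mul L2
  have I2 := hφ.integrable_mul L3
  have I3 := (hφ.pderivI i).integrable_mul L1
  have e1 : ∫ x, g x * w' x = (∫ x, f' x * g x * φ x) + ∫ x, f x * g x * pderivI d i φ x := by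
    rw [← integral_add I1 I3]
    congr 1; funext x; simp only [hw']; ring
  have e2 : ∫ x, (f' x * g x + f x * g' x) * φ x
      = (∫ x, f' x * g x * φ x) + ∫ x, f x * g' x * φ x := by
    rw [← integral_add I1 I2]
    congr 1; funext x; ring
  have e3 : ∫ x, g' x * w x = ∫ x, f x * g' x * φ x := by
    congr 1; funext x; simp only [hw]; ring
  rw [e1, e3] at hlim
  rw [e2]
  linarith

/-- weighted integrability implies local integrability -/
lemma LLp_of_wt {d ℓ : ℕ} {b : ℝ} {q : ℝ≥0∞} {f : Ed d → ℝ}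
    (hf : AEStronglyMeasurable f volume) (h : eLpNorm (wt d ℓ b f) q volume < ⊤) :
    LLp d (ModelDomain d ℓ) q f := by
  intro K hK hKΩ
  have hc : ContinuousOn (fun x => rhoModel d ℓ x ^ (-b)) K := by
    apply (rho_continuous d ℓ).continuousOn.rpow_const
    intro x hx
    exact Or.inl (rho_pos (hKΩ hx)).ne'
  obtain ⟨C, hC⟩ := hK.exists_bound_of_continuousOn hc
  have hm : MemLp (wt d ℓ b f) q (volume.restrict K) :=
    (show MemLp (wt d ℓ b f) q volume from ⟨wt_aesm b hf, h⟩).restrict K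
  refine (hm.const_mul C).mono hf.restrict ?_
  filter_upwards [ae_restrict_mem hK.measurableSet] with x hx
  have h1 := hC x hx
  have h3 : 0 ≤ C := (norm_nonneg _).trans h1
  have hr := rho_pos (hKΩ hx)
  have e : f x = rhoModel d ℓ x ^ (-b) * wt d ℓ b f x := by
    rw [wt, ← mul_assoc, ← Real.rpow_add hr]; simp
  rw [e, norm_mul, norm_mul, Real.norm_of_nonneg h3]
  gcongr

/-- the Sobolev exponent -/
def qN (d : ℕ) (p s : ℝ) : ℝ≥0 := Real.toNNReal ((1 / p - s / d)⁻¹)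

/-- order of a multiindex, as a real number -/
def ordR {d : ℕ} (α : Fin d → ℕ) : ℝ := ((∑ i, α i : ℕ) : ℝ)

/-- the sum of the weighted norms -/
def KN (d ℓ m : ℕ) (a p : ℝ) (D : (Fin d → ℕ) → Ed d → ℝ) : ℝ≥0∞ :=
  ∑ α ∈ multiIdx d m, eLpNorm (wt d ℓ (ordR α - a) (D α)) (ENNReal.ofReal p) volume

lemma ordR_add_single {d : ℕ} (α : Fin d → ℕ) (i : Fin d) :
    ordR (α + Pi.single i 1) = ordR α + 1 := by
  rw [ordR, ordR, sum_add_single]; push_cast; rfl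

lemma qpos {d : ℕ} {p s : ℝ} (hd : 0 < d) (hp : 0 < p) (hs : s < d / p) : 0 < 1 / p - s / d := by
  have hd' : (0:ℝ) < d := by exact_mod_cast hd
  rw [sub_pos, div_lt_div_iff₀ hd' hp]
  rw [lt_div_iff₀ hp] at hs
  linarith

lemma qN_coe {d : ℕ} {p s : ℝ} (hd : 0 < d) (hp : 0 < p) (hs : s < d / p) :
    ((qN d p s : ℝ≥0) : ℝ) = (1 / p - s / d)⁻¹ :=
  Real.coe_toNNReal _ (inv_pos.2 (qpos hd hp hs)).le

lemma qN_ge {d : ℕ} {p s : ℝ} (hd : 0 < d) (hp : 1 ≤ p) (hs : s < d / p) (hs0 : 0 ≤ s) :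
    1 ≤ qN d p s := by
  have h := qpos hd (by linarith) hs
  have : (1:ℝ) ≤ (qN d p s : ℝ≥0) := by
    rw [qN_coe hd (by linarith) hs]
    rw [one_le_inv₀ h]
    have h1 : 1 / p ≤ 1 := by rw [div_le_one (by linarith)]; exact hp
    have : 0 ≤ s / d := by positivity
    linarith
  exact_mod_cast this

lemma qN_zero {d : ℕ} {p : ℝ} : ((qN d p 0 : ℝ≥0) : ℝ≥0∞) = ENNReal.ofReal p := by
  simp [qN, ENNReal.ofReal]

lemma le_KN {d ℓ m : ℕ} {a p : ℝ} (D : (Fin d → ℕ) → Ed d → ℝ) {α : Fin d → ℕ}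
    (h : ∑ i, α i ≤ m) :
    eLpNorm (wt d ℓ (ordR α - a) (D α)) (ENNReal.ofReal p) volume ≤ KN d ℓ m a p D :=
  Finset.single_le_sum (f := fun α => eLpNorm (wt d ℓ (ordR α - a) (D α)) (ENNReal.ofReal p) volume)
    (fun _ _ => zero_le) (mem_multiIdx.2 h)

lemma sobolev_iter {d ℓ m : ℕ} (hl : ℓ < d) (a p : ℝ) (hp : 1 ≤ p) (k : ℕ) (hk : (k : ℝ) < d / p) :
    ∀ β : Fin d → ℕ, (∑ i, β i) + k ≤ m → ∃ C : ℝ≥0, ∀ u D,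
      IsWeakDerivFamily d (ModelDomain d ℓ) m u D →
      eLpNorm (wt d ℓ (ordR β - a + k) (D β)) (qN d p k) volume ≤ C * KN d ℓ m a p D := by
  have hd : 0 < d := by omega
  induction k with
  | zero =>
    intro β hβ
    refine ⟨1, fun u D _ => ?_⟩
    have := le_KN (ℓ := ℓ) (a := a) (p := p) D (by omega : ∑ i, β i ≤ m)
    simpa [qN_zero] using this
  | succ k ih =>
    intro β hβ
    have hk' : (k : ℝ) < d / p := lt_of_le_of_lt (by push_cast; linarith) hk
    obtain ⟨C0, hC0⟩ := ih hk' β (by omega)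
    have hi : ∀ i : Fin d, ∃ C : ℝ≥0, ∀ u D,
      IsWeakDerivFamily d (ModelDomain d ℓ) m u D →
      eLpNorm (wt d ℓ (ordR (β + Pi.single i 1) - a + k) (D (β + Pi.single i 1))) (qN d p k) volume
        ≤ C * KN d ℓ m a p D := fun i => ih hk' _ (by rw [sum_add_single]; omega)
    choose Ci hCi using hi
    obtain ⟨S, hS⟩ := sobolev_step hl (ordR β - a + (k + 1 : ℕ)) (p := qN d p k)
      (p' := qN d p (k + 1 : ℕ)) (qN_ge hd hp hk' (by positivity)) (by
        rw [qN_coe hd (by linarith) hk, qN_coe hd (by linarith) hk', inv_inv, inv_inv]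
        have : (d : ℝ) ≠ 0 := by positivity
        push_cast
        field_simp
        ring)
    refine ⟨S * (C0 + ∑ i, Ci i), fun u D hD => ?_⟩
    refine (hS (D β) (fun i => D (β + Pi.single i 1)) (fun i => WD1_of_hasWeakDerivOn
      (hD _ (mem_multiIdx.2 (by omega)))
      (hD _ (mem_multiIdx.2 (by rw [sum_add_single]; omega))))).trans ?_
    push_cast
    rw [mul_assoc, add_mul, Finset.sum_mul]
    gcongr with i _
    · have e : ordR β - a + ((k : ℝ) + 1) - 1 = ordR β - a + k := by ring
      rw [e]
      exact hC0 u D hD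
    · have e : ordR β - a + ((k : ℝ) + 1) = ordR (β + Pi.single i 1) - a + k := by
        rw [ordR_add_single]; ring
      rw [e]
      exact hCi i u D hD

lemma interp {d : ℕ} {F G H : Ed d → ℝ} (hF : AEStronglyMeasurable F volume)
    (hG : AEStronglyMeasurable G volume) {P Q R θ : ℝ} (hP : 0 < P) (hQ : 0 < Q) (hR : 0 < R)
    (h0 : 0 ≤ θ) (h1 : θ ≤ 1) (hPQ : R⁻¹ = (1 - θ) * P⁻¹ + θ * Q⁻¹)
    (hH : ∀ᵐ x, |H x| = |F x| ^ (1 - θ) * |G x| ^ θ) :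
    eLpNorm H (ENNReal.ofReal R) volume ≤
      eLpNorm F (ENNReal.ofReal P) volume ^ (1 - θ) * eLpNorm G (ENNReal.ofReal Q) volume ^ θ := by
  have hn : ∀ {r : ℝ}, 0 < r → ∀ f : Ed d → ℝ, eLpNorm f (ENNReal.ofReal r) volume
      = (∫⁻ x, ‖f x‖ₑ ^ r) ^ (1 / r) := by
    intro r hr f
    rw [eLpNorm_eq_lintegral_rpow_enorm_toReal (by simpa using hr) (by simp),
      ENNReal.toReal_ofReal hr.le]
  rw [hn hP, hn hQ, hn hR]
  have key := ENNReal.lintegral_mul_norm_pow_le (μ := (volume : Measure (Ed d)))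
    (f := fun x => ‖F x‖ₑ ^ P) (g := fun x => ‖G x‖ₑ ^ Q) (hF.enorm.pow_const P) (hG.enorm.pow_const Q)
    (p := R * ((1 - θ) * P⁻¹)) (q := R * (θ * Q⁻¹))
    (by have := sub_nonneg.2 h1; positivity) (by positivity)
    (by rw [← mul_add, ← hPQ, mul_inv_cancel₀ hR.ne'])
  have e : ∫⁻ x, ‖H x‖ₑ ^ R = ∫⁻ x, (‖F x‖ₑ ^ P) ^ (R * ((1 - θ) * P⁻¹)) * (‖G x‖ₑ ^ Q) ^ (R * (θ * Q⁻¹)) := by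
    apply lintegral_congr_ae
    filter_upwards [hH] with x hx
    have e1 : ‖H x‖ₑ = ‖F x‖ₑ ^ (1 - θ) * ‖G x‖ₑ ^ θ := by
      rw [← ofReal_norm_eq_enorm, ← ofReal_norm_eq_enorm, ← ofReal_norm_eq_enorm, Real.norm_eq_abs, hx,
        ENNReal.ofReal_mul (by positivity),
        ENNReal.ofReal_rpow_of_nonneg (norm_nonneg _) (by linarith),
        ENNReal.ofReal_rpow_of_nonneg (norm_nonneg _) h0]
      rfl
    rw [e1, ENNReal.mul_rpow_of_nonneg _ _ hR.le, ← ENNReal.rpow_mul, ← ENNReal.rpow_mul,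
      ← ENNReal.rpow_mul, ← ENNReal.rpow_mul]
    congr 2 <;> field_simp
  rw [e]
  refine (ENNReal.rpow_le_rpow key (by positivity)).trans (le_of_eq ?_)
  rw [ENNReal.mul_rpow_of_nonneg _ _ (by positivity), ← ENNReal.rpow_mul, ← ENNReal.rpow_mul,
      ← ENNReal.rpow_mul, ← ENNReal.rpow_mul]
  congr 2 <;> field_simp

lemma embed {d ℓ m : ℕ} (hl : ℓ < d) (a p : ℝ) (hp : 1 ≤ p) (hm : (m : ℝ) < d / p)
    (β : Fin d → ℕ) (s : ℝ) (hs0 : 0 ≤ s) (hs : ordR β + s ≤ m) : ∃ C : ℝ≥0, ∀ u D,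
      IsWeakDerivFamily d (ModelDomain d ℓ) m u D →
      eLpNorm (wt d ℓ (ordR β - a + s) (D β)) (qN d p s) volume ≤ C * KN d ℓ m a p D := by
  have hd : 0 < d := by omega
  have hβ : ∑ i, β i ≤ m := by
    have : ordR β ≤ m := by linarith
    unfold ordR at this
    exact_mod_cast this
  have hβ0 : 0 ≤ ordR β := by unfold ordR; positivity
  rcases hs0.eq_or_lt with rfl | hs0
  · refine ⟨1, fun u D _ => ?_⟩
    have := le_KN (ℓ := ℓ) (a := a) (p := p) D hβ
    simpa [qN_zero] using this
  obtain ⟨k, hk⟩ := Nat.exists_eq_add_of_le hβ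
  have hk1 : (m : ℝ) = ordR β + k := by rw [hk]; push_cast [ordR]; rfl
  have hkp : (k : ℝ) < d / p := by linarith
  have hsk : s ≤ k := by linarith
  have hk0 : (0:ℝ) < k := by linarith
  obtain ⟨C, hC⟩ := sobolev_iter hl a p hp k hkp β (by omega) (m := m)
  refine ⟨1 + C, fun u D hD => ?_⟩
  have hmeas : AEStronglyMeasurable (D β) volume := locInt_aesm hl (hD β (mem_multiIdx.2 hβ)).2.1
  have hC' := hC u D hD
  have hN := le_KN (ℓ := ℓ) (a := a) (p := p) D hβ
  set N := KN d ℓ m a p D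
  have hdd : (0:ℝ) < d := by exact_mod_cast hd
  have hi := interp (wt_aesm (ℓ := ℓ) (ordR β - a) hmeas) (wt_aesm (ℓ := ℓ) (ordR β - a + k) hmeas)
    (H := wt d ℓ (ordR β - a + s) (D β))
    (P := p) (Q := (1 / p - k / d)⁻¹) (R := (1 / p - s / d)⁻¹) (θ := s / k) (by linarith)
    (inv_pos.2 (qpos hd (by linarith) hkp)) (inv_pos.2 (qpos hd (by linarith) (by linarith)))
    (by positivity) ((div_le_one hk0).2 hsk) (by
      rw [inv_inv, inv_inv]; field_simp; ring) (by
      filter_upwards [ae_mem_ModelDomain hl] with x hx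
      have hr := rho_pos hx
      have hth0 : 0 ≤ s / k := by positivity
      have hth1 : s / k ≤ 1 := (div_le_one hk0).2 hsk
      simp only [wt, abs_mul, abs_of_nonneg (Real.rpow_nonneg hr.le _)]
      rw [Real.mul_rpow (by positivity) (abs_nonneg _), Real.mul_rpow (by positivity) (abs_nonneg _),
        mul_mul_mul_comm, ← Real.rpow_mul hr.le, ← Real.rpow_mul hr.le, ← Real.rpow_add hr,
        ← Real.rpow_add_of_nonneg (abs_nonneg _) (by linarith) hth0]
      congr 1
      · congr 1; field_simp; ring
      · simp)
  refine hi.trans ?_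
  have hth0 : 0 ≤ s / k := by positivity
  have hth1 : s / k ≤ 1 := (div_le_one hk0).2 hsk
  have c1 : eLpNorm (wt d ℓ (ordR β - a) (D β)) (ENNReal.ofReal p) volume ≤ ((1 + C : ℝ≥0) : ℝ≥0∞) * N := by
    refine hN.trans ?_
    push_cast
    rw [add_mul, one_mul]
    exact le_self_add
  have c2 : eLpNorm (wt d ℓ (ordR β - a + k) (D β)) (ENNReal.ofReal ((1 / p - k / d)⁻¹)) volume
      ≤ ((1 + C : ℝ≥0) : ℝ≥0∞) * N := by
    refine le_trans hC' ?_
    push_cast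
    rw [add_mul]
    exact le_add_self
  calc _ ≤ (((1 + C : ℝ≥0) : ℝ≥0∞) * N) ^ (1 - s / k) * (((1 + C : ℝ≥0) : ℝ≥0∞) * N) ^ (s / k) := by
        have : 0 ≤ 1 - s / k := by linarith
        gcongr
    _ = _ := by
        rw [← ENNReal.rpow_add_of_nonneg _ _ (by linarith) hth0]
        simp

lemma qN_holder {d : ℕ} {p s s' : ℝ} (hd : 0 < d) (hp : 1 ≤ p) (hs : s < d / p)
    (hs' : s' < d / p) (h : s + s' = d / p) :
    ENNReal.HolderTriple (qN d p s : ℝ≥0) (qN d p s' : ℝ≥0) (ENNReal.ofReal p) := by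
  have h1 := qpos hd (by linarith) hs
  have h2 := qpos hd (by linarith) hs'
  have hdd : (0:ℝ) < d := by exact_mod_cast hd
  constructor
  change (ENNReal.ofReal _)⁻¹ + (ENNReal.ofReal _)⁻¹ = _
  rw [← ENNReal.ofReal_inv_of_pos (inv_pos.2 h1), ← ENNReal.ofReal_inv_of_pos (inv_pos.2 h2),
    ← ENNReal.ofReal_inv_of_pos (by linarith), inv_inv, inv_inv, ← ENNReal.ofReal_add h1.le h2.le]
  congr 1
  have e : s' = d / p - s := by linarith
  rw [e]
  field_simp
  ring

lemma family_LLp {d ℓ m : ℕ} (hl : ℓ < d) {a p : ℝ} (hp : 1 ≤ p) (hm : (m : ℝ) < d / p)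
    {u : Ed d → ℝ} {D : (Fin d → ℕ) → Ed d → ℝ}
    (hD : IsWeakDerivFamily d (ModelDomain d ℓ) m u D) (hN : KN d ℓ m a p D < ⊤)
    (β : Fin d → ℕ) (s : ℝ) (hs0 : 0 ≤ s) (hs : ordR β + s ≤ m) :
    LLp d (ModelDomain d ℓ) (qN d p s : ℝ≥0) (D β) := by
  obtain ⟨C, hC⟩ := embed hl a p hp hm β s hs0 hs
  have hβ : ∑ i, β i ≤ m := by
    have : ordR β ≤ m := by linarith
    unfold ordR at this
    exact_mod_cast this
  exact LLp_of_wt (locInt_aesm hl (hD β (mem_multiIdx.2 hβ)).2.1)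
    ((hC u D hD).trans_lt (ENNReal.mul_lt_top ENNReal.coe_lt_top hN))

lemma WD1.zero {d : ℕ} {Ω : Set (Ed d)} {i : Fin d} : WD1 d Ω i (fun _ => 0) (fun _ => 0) := by
  have h0 : LocallyIntegrableOn (fun _ : Ed d => (0:ℝ)) Ω volume :=
    (locallyIntegrable_const 0).locallyIntegrableOn _
  exact ⟨h0, h0, by simp⟩

lemma WD1.add {d : ℕ} {Ω : Set (Ed d)} {i : Fin d} {f f' g g' : Ed d → ℝ}
    (hf : WD1 d Ω i f f') (hg : WD1 d Ω i g g') :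
    WD1 d Ω i (fun x => f x + g x) (fun x => f' x + g' x) := by
  refine ⟨hf.1.add hg.1, hf.2.1.add hg.2.1, fun φ hφ => ?_⟩
  simp only [add_mul]
  rw [integral_add ((hφ.pderivI i).integrable_mul hf.1) ((hφ.pderivI i).integrable_mul hg.1),
    integral_add (hφ.integrable_mul hf.2.1) (hφ.integrable_mul hg.2.1), hf.2.2 φ hφ, hg.2.2 φ hφ]
  ring

/-- a finite sum of products of derivatives -/
def lsum {d : ℕ} (L : List ((Fin d → ℕ) × (Fin d → ℕ))) (D E : (Fin d → ℕ) → Ed d → ℝ) :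
    Ed d → ℝ := fun x => (L.map (fun q => D q.1 x * E q.2 x)).sum

lemma lsum_nil {d : ℕ} (D E : (Fin d → ℕ) → Ed d → ℝ) : lsum [] D E = fun _ => 0 := by
  funext x; simp [lsum]

lemma lsum_cons {d : ℕ} (q) (L : List ((Fin d → ℕ) × (Fin d → ℕ)))
    (D E : (Fin d → ℕ) → Ed d → ℝ) :
    lsum (q :: L) D E = fun x => D q.1 x * E q.2 x + lsum L D E x := by
  funext x; simp [lsum]

/-- the Leibniz rule on lists of pairs of multiindices -/
def lder {d : ℕ} (i : Fin d) : List ((Fin d → ℕ) × (Fin d → ℕ)) → List ((Fin d → ℕ) × (Fin d → ℕ))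
  | [] => []
  | q :: L => (q.1 + Pi.single i 1, q.2) :: (q.1, q.2 + Pi.single i 1) :: lder i L

lemma lder_ord {d : ℕ} (i : Fin d) {r : ℝ} : ∀ L : List ((Fin d → ℕ) × (Fin d → ℕ)),
    (∀ q ∈ L, ordR q.1 + ordR q.2 = r) → ∀ q ∈ lder i L, ordR q.1 + ordR q.2 = r + 1
  | [], _ => by simp [lder]
  | q :: L, h => by
    have h1 := h q (by simp)
    have h2 := lder_ord i L (fun q hq => h q (by simp [hq]))
    intro q' hq'
    simp only [lder, List.mem_cons] at hq'
    rcases hq' with rfl | rfl | hq'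
    · simp only [ordR_add_single]; linarith
    · simp only [ordR_add_single]; linarith
    · exact h2 _ hq'

lemma ordR_nonneg {d : ℕ} (α : Fin d → ℕ) : 0 ≤ ordR α := by unfold ordR; positivity

lemma wd_pair {d ℓ m₀ m₁ m₂ : ℕ} (hl : ℓ < d) {a₀ a₁ p : ℝ} (hp : 1 < p)
    (h2 : (m₀ : ℝ) < d / p) (h3 : (m₁ : ℝ) < d / p) (h4 : (m₂ : ℝ) ≤ m₀ + m₁ - d / p)
    {u v : Ed d → ℝ} {D E : (Fin d → ℕ) → Ed d → ℝ}
    (hD : IsWeakDerivFamily d (ModelDomain d ℓ) m₀ u D) (hN : KN d ℓ m₀ a₀ p D < ⊤)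
    (hE : IsWeakDerivFamily d (ModelDomain d ℓ) m₁ v E) (hN' : KN d ℓ m₁ a₁ p E < ⊤)
    (i : Fin d) (β γ : Fin d → ℕ) (hβγ : ordR β + ordR γ + 1 ≤ m₂) :
    WD1 d (ModelDomain d ℓ) i (fun x => D β x * E γ x)
      (fun x => D (β + Pi.single i 1) x * E γ x + D β x * E (γ + Pi.single i 1) x) := by
  have hd : 0 < d := by omega
  have hb := ordR_nonneg β
  have hg := ordR_nonneg γ
  have nb : ∑ i, β i + 1 ≤ m₀ := by
    have : ordR β + 1 ≤ m₀ := by linarith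
    unfold ordR at this
    exact_mod_cast this
  have ng : ∑ i, γ i + 1 ≤ m₁ := by
    have : ordR γ + 1 ≤ m₁ := by linarith
    unfold ordR at this
    exact_mod_cast this
  have w1 : WD1 d (ModelDomain d ℓ) i (D β) (D (β + Pi.single i 1)) :=
    WD1_of_hasWeakDerivOn (hD _ (mem_multiIdx.2 (by omega)))
      (hD _ (mem_multiIdx.2 (by rw [sum_add_single]; omega)))
  have w2 : WD1 d (ModelDomain d ℓ) i (E γ) (E (γ + Pi.single i 1)) :=
    WD1_of_hasWeakDerivOn (hE _ (mem_multiIdx.2 (by omega)))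
      (hE _ (mem_multiIdx.2 (by rw [sum_add_single]; omega)))
  set s := (m₀ : ℝ) - ordR β - 1 with hs
  set s' := (d : ℝ) / p - s with hs'
  set r := (m₀ : ℝ) - ordR β with hr
  set r' := (d : ℝ) / p - r with hr'
  have bL := family_LLp hl hp.le h2 hD hN
  have bL' := family_LLp hl hp.le h3 hE hN'
  exact WD1.mul (isOpen_ModelDomain d ℓ) w1 w2 (s := (qN d p s : ℝ≥0)) (s' := (qN d p s' : ℝ≥0))
    (r := (qN d p r : ℝ≥0)) (r' := (qN d p r' : ℝ≥0)) (p := ENNReal.ofReal p)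
    (by simpa using hp.le)
    (by exact_mod_cast qN_ge hd hp.le (by linarith) (by linarith)) ENNReal.coe_ne_top
    (by exact_mod_cast qN_ge hd hp.le (by linarith) (by linarith)) ENNReal.coe_ne_top
    (qN_holder hd hp.le (by linarith) (by linarith) (by linarith))
    (qN_holder hd hp.le (by linarith) (by linarith) (by linarith))
    (bL _ _ (by linarith) (by linarith))
    (bL _ _ (by linarith) (by rw [ordR_add_single]; linarith))
    (bL' _ _ (by linarith) (by linarith))
    (bL _ _ (by linarith) (by linarith))
    (bL' _ _ (by linarith) (by rw [ordR_add_single]; linarith))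

lemma wd_list {d ℓ m₀ m₁ m₂ : ℕ} (hl : ℓ < d) {a₀ a₁ p : ℝ} (hp : 1 < p)
    (h2 : (m₀ : ℝ) < d / p) (h3 : (m₁ : ℝ) < d / p) (h4 : (m₂ : ℝ) ≤ m₀ + m₁ - d / p)
    {u v : Ed d → ℝ} {D E : (Fin d → ℕ) → Ed d → ℝ}
    (hD : IsWeakDerivFamily d (ModelDomain d ℓ) m₀ u D) (hN : KN d ℓ m₀ a₀ p D < ⊤)
    (hE : IsWeakDerivFamily d (ModelDomain d ℓ) m₁ v E) (hN' : KN d ℓ m₁ a₁ p E < ⊤)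
    (i : Fin d) : ∀ L : List ((Fin d → ℕ) × (Fin d → ℕ)),
    (∀ q ∈ L, ordR q.1 + ordR q.2 + 1 ≤ m₂) →
    WD1 d (ModelDomain d ℓ) i (lsum L D E) (lsum (lder i L) D E)
  | [], _ => by rw [lder, lsum_nil]; exact WD1.zero
  | q :: L, h => by
    have h1 := wd_pair hl hp h2 h3 h4 hD hN hE hN' i q.1 q.2 (h q (by simp))
    have h2 := wd_list hl hp h2 h3 h4 hD hN hE hN' i L (fun q hq => h q (by simp [hq]))
    have := h1.add h2
    rw [lder, lsum_cons, lsum_cons, lsum_cons]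
    simpa only [add_assoc] using this

lemma leib_zero {d ℓ m₀ m₁ m₂ : ℕ} (hl : ℓ < d) {a₀ a₁ p : ℝ} (hp : 1 < p)
    (h2 : (m₀ : ℝ) < d / p) (h3 : (m₁ : ℝ) < d / p) (h4 : (m₂ : ℝ) ≤ m₀ + m₁ - d / p)
    {u v : Ed d → ℝ} {D E : (Fin d → ℕ) → Ed d → ℝ}
    (hD : IsWeakDerivFamily d (ModelDomain d ℓ) m₀ u D) (hN : KN d ℓ m₀ a₀ p D < ⊤)
    (hE : IsWeakDerivFamily d (ModelDomain d ℓ) m₁ v E) (hN' : KN d ℓ m₁ a₁ p E < ⊤) :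
    HasWeakDerivOn d (ModelDomain d ℓ) 0 (u * v) (fun x => D 0 x * E 0 x) := by
  have hd : 0 < d := by omega
  have z : ordR (0 : Fin d → ℕ) = 0 := by simp [ordR]
  have hm2 : (0:ℝ) ≤ m₂ := by positivity
  have e1 : ∀ {m : ℕ} {w : Ed d → ℝ} {F : (Fin d → ℕ) → Ed d → ℝ},
      IsWeakDerivFamily d (ModelDomain d ℓ) m w F → ∀ᵐ x, w x = F 0 x := by
    intro m w F hF
    have h0 := hF 0 (mem_multiIdx.2 (by simp))
    have : HasWeakDerivOn d (ModelDomain d ℓ) 0 w w :=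
      ⟨h0.1, h0.1, fun φ _ => by simp [pderivA_zero]⟩
    filter_upwards [weakDeriv_unique (isOpen_ModelDomain d ℓ) this h0, ae_mem_ModelDomain hl] with x h h'
    exact h h'
  have hu := e1 hD
  have hv := e1 hE
  have bL := family_LLp hl hp.le h2 hD hN 0 m₀ (by positivity) (by linarith)
  have bL' := family_LLp hl hp.le h3 hE hN' 0 (d / p - m₀) (by linarith) (by linarith)
  have L := LLp.mul_locInt (isOpen_ModelDomain d ℓ) (by simpa using hp.le)
    (qN_holder hd hp.le h2 (by linarith) (by linarith)) bL bL'
  have hae : ∀ᵐ x, D 0 x * E 0 x = (u * v) x := by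
    filter_upwards [hu, hv] with x h h'
    simp [h, h']
  refine ⟨?_, L, fun φ _ => ?_⟩
  · rw [locallyIntegrableOn_iff (isOpen_ModelDomain d ℓ).isLocallyClosed] at L ⊢
    intro K hK hKc
    exact (L K hK hKc).congr (ae_restrict_of_ae hae)
  · simp only [pderivA_zero, Pi.zero_apply, Finset.sum_const_zero, pow_zero, one_mul]
    apply integral_congr_ae
    filter_upwards [ae_restrict_of_ae hae] with x hx
    rw [hx]

lemma leib {d ℓ m₀ m₁ m₂ : ℕ} (hl : ℓ < d) {a₀ a₁ p : ℝ} (hp : 1 < p)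
    (h2 : (m₀ : ℝ) < d / p) (h3 : (m₁ : ℝ) < d / p) (h4 : (m₂ : ℝ) ≤ m₀ + m₁ - d / p) (n : ℕ) :
    ∀ α : Fin d → ℕ, ∑ i, α i = n → n ≤ m₂ →
    ∃ L : List ((Fin d → ℕ) × (Fin d → ℕ)), (∀ q ∈ L, ordR q.1 + ordR q.2 = ordR α) ∧
      ∀ (u v : Ed d → ℝ) (D E : (Fin d → ℕ) → Ed d → ℝ),
      IsWeakDerivFamily d (ModelDomain d ℓ) m₀ u D → KN d ℓ m₀ a₀ p D < ⊤ →
      IsWeakDerivFamily d (ModelDomain d ℓ) m₁ v E → KN d ℓ m₁ a₁ p E < ⊤ →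
      HasWeakDerivOn d (ModelDomain d ℓ) α (u * v) (lsum L D E) := by
  induction n with
  | zero =>
    intro α hα _
    have hα0 : α = 0 := by
      funext i
      have := (Finset.sum_eq_zero_iff.1 hα) i (Finset.mem_univ i)
      simpa using this
    subst hα0
    refine ⟨[(0, 0)], by simp [ordR], fun u v D E hD hN hE hN' => ?_⟩
    have e : lsum [((0 : Fin d → ℕ), (0 : Fin d → ℕ))] D E = fun x => D 0 x * E 0 x := by
      rw [lsum_cons, lsum_nil]; simp
    rw [e]
    exact leib_zero hl hp h2 h3 h4 hD hN hE hN'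
  | succ n ih =>
    intro α hα hn
    obtain ⟨i, hi⟩ : ∃ i, α i ≠ 0 := by
      by_contra! h
      simp [h] at hα
    set β : Fin d → ℕ := Function.update α i (α i - 1) with hβ
    have hαβ : α = β + Pi.single i 1 := by
      funext j
      by_cases hj : j = i
      · subst hj; simp [hβ]; omega
      · simp [hβ, hj]
    have hβn : ∑ i, β i = n := by
      have := sum_add_single β i
      rw [← hαβ, hα] at this
      omega
    obtain ⟨L, hL, hW⟩ := ih β hβn (by omega)
    have hor : ordR α = ordR β + 1 := by rw [hαβ, ordR_add_single]
    have hle : ordR β + 1 ≤ m₂ := by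
      unfold ordR; rw [hβn]; exact_mod_cast hn
    refine ⟨lder i L, ?_, fun u v D E hD hN hE hN' => ?_⟩
    · rw [hor]; exact lder_ord i L hL
    · rw [hαβ]
      exact hasWeakDerivOn_succ (hW u v D E hD hN hE hN')
        (wd_list hl hp h2 h3 h4 hD hN hE hN' i L (fun q hq => by rw [hL q hq]; exact hle))

lemma pair_bound {d ℓ m₀ m₁ m₂ : ℕ} (hl : ℓ < d) (a₀ a₁ : ℝ) {p : ℝ} (hp : 1 < p)
    (h2 : (m₀ : ℝ) < d / p) (h3 : (m₁ : ℝ) < d / p) (h4 : (m₂ : ℝ) ≤ m₀ + m₁ - d / p)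
    (β γ : Fin d → ℕ) (hβγ : ordR β + ordR γ ≤ m₂) :
    ∃ C : ℝ≥0, ∀ (u v : Ed d → ℝ) (D E : (Fin d → ℕ) → Ed d → ℝ),
      IsWeakDerivFamily d (ModelDomain d ℓ) m₀ u D →
      IsWeakDerivFamily d (ModelDomain d ℓ) m₁ v E →
      AEStronglyMeasurable (fun x => D β x * E γ x) volume ∧
      eLpNorm (wt d ℓ (ordR β + ordR γ - (a₀ + a₁ - d / p)) (fun x => D β x * E γ x))
        (ENNReal.ofReal p) volume ≤ C * (KN d ℓ m₀ a₀ p D * KN d ℓ m₁ a₁ p E) := by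
  have hd : 0 < d := by omega
  have hb := ordR_nonneg β
  have hg := ordR_nonneg γ
  have nb : ∑ i, β i ≤ m₀ := by
    have : ordR β ≤ m₀ := by linarith
    unfold ordR at this
    exact_mod_cast this
  have ng : ∑ i, γ i ≤ m₁ := by
    have : ordR γ ≤ m₁ := by linarith
    unfold ordR at this
    exact_mod_cast this
  set s := (m₀ : ℝ) - ordR β with hs
  set s' := (d : ℝ) / p - s with hs'
  obtain ⟨C, hC⟩ := embed hl a₀ p hp.le h2 β s (by linarith) (by linarith)
  obtain ⟨C', hC'⟩ := embed hl a₁ p hp.le h3 γ s' (by linarith) (by linarith)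
  refine ⟨C * C', fun u v D E hD hE => ?_⟩
  have m1 := locInt_aesm hl (hD β (mem_multiIdx.2 nb)).2.1
  have m2 := locInt_aesm hl (hE γ (mem_multiIdx.2 ng)).2.1
  refine ⟨m1.mul m2, ?_⟩
  have hH := qN_holder hd hp.le (by linarith : s < d / p) (by linarith : s' < d / p) (by linarith)
  have e : eLpNorm (wt d ℓ (ordR β + ordR γ - (a₀ + a₁ - d / p)) (fun x => D β x * E γ x))
        (ENNReal.ofReal p) volume
      = eLpNorm (wt d ℓ (ordR β - a₀ + s) (D β) • wt d ℓ (ordR γ - a₁ + s') (E γ))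
        (ENNReal.ofReal p) volume := by
    apply eLpNorm_congr_ae
    filter_upwards [ae_mem_ModelDomain hl] with x hx
    have hr := rho_pos hx
    have ee : ordR β + ordR γ - (a₀ + a₁ - d / p) = (ordR β - a₀ + s) + (ordR γ - a₁ + s') := by
      rw [hs']; ring
    simp only [wt, Pi.smul_apply', smul_eq_mul]
    rw [ee, Real.rpow_add hr]
    ring
  rw [e]
  refine (eLpNorm_smul_le_mul_eLpNorm (wt_aesm _ m2) (wt_aesm _ m1)
    (p := (qN d p s : ℝ≥0)) (q := (qN d p s' : ℝ≥0))).trans ?_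
  calc _ ≤ (C * KN d ℓ m₀ a₀ p D) * (C' * KN d ℓ m₁ a₁ p E) := by
        gcongr
        · exact hC u D hD
        · exact hC' v E hE
    _ = _ := by push_cast; ring

lemma list_bound {d ℓ m₀ m₁ m₂ : ℕ} (hl : ℓ < d) (a₀ a₁ : ℝ) {p : ℝ} (hp : 1 < p)
    (h2 : (m₀ : ℝ) < d / p) (h3 : (m₁ : ℝ) < d / p) (h4 : (m₂ : ℝ) ≤ m₀ + m₁ - d / p)
    {r : ℝ} (hr : r ≤ m₂) : ∀ L : List ((Fin d → ℕ) × (Fin d → ℕ)),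
    (∀ q ∈ L, ordR q.1 + ordR q.2 = r) →
    ∃ C : ℝ≥0, ∀ (u v : Ed d → ℝ) (D E : (Fin d → ℕ) → Ed d → ℝ),
      IsWeakDerivFamily d (ModelDomain d ℓ) m₀ u D →
      IsWeakDerivFamily d (ModelDomain d ℓ) m₁ v E →
      AEStronglyMeasurable (lsum L D E) volume ∧
      eLpNorm (wt d ℓ (r - (a₀ + a₁ - d / p)) (lsum L D E))
        (ENNReal.ofReal p) volume ≤ C * (KN d ℓ m₀ a₀ p D * KN d ℓ m₁ a₁ p E)
  | [], _ => by
    refine ⟨0, fun u v D E _ _ => ⟨?_, ?_⟩⟩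
    · rw [lsum_nil]; exact aestronglyMeasurable_const
    · have : wt d ℓ (r - (a₀ + a₁ - d / p)) (lsum [] D E) = 0 := by
        funext x; simp [wt, lsum]
      rw [this]; simp
  | q :: L, h => by
    have hq := h q (by simp)
    obtain ⟨C1, hC1⟩ := pair_bound hl a₀ a₁ hp h2 h3 h4 q.1 q.2 (by rw [hq]; exact hr)
    obtain ⟨C2, hC2⟩ := list_bound hl a₀ a₁ hp h2 h3 h4 hr L (fun q hq => h q (by simp [hq]))
    refine ⟨C1 + C2, fun u v D E hD hE => ?_⟩
    obtain ⟨k1, k2⟩ := hC1 u v D E hD hE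
    obtain ⟨k3, k4⟩ := hC2 u v D E hD hE
    rw [hq] at k2
    have e : lsum (q :: L) D E = fun x => D q.1 x * E q.2 x + lsum L D E x := by
      funext x; simp [lsum]
    rw [e]
    refine ⟨k1.add k3, ?_⟩
    have e2 : wt d ℓ (r - (a₀ + a₁ - d / p)) (fun x => D q.1 x * E q.2 x + lsum L D E x)
      = wt d ℓ (r - (a₀ + a₁ - d / p)) (fun x => D q.1 x * E q.2 x)
        + wt d ℓ (r - (a₀ + a₁ - d / p)) (lsum L D E) := by
      funext x; simp only [wt, Pi.add_apply]; ring
    rw [e2]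
    refine (eLpNorm_add_le (wt_aesm _ k1) (wt_aesm _ k3) (by simpa using hp.le)).trans ?_
    push_cast
    rw [add_mul]
    gcongr

lemma kIntegrand_eq {d ℓ : ℕ} (a p : ℝ) (α : Fin d → ℕ) (v : Ed d → ℝ) :
    kIntegrand d (rhoModel d ℓ) a p α v = fun x => ‖wt d ℓ (ordR α - a) v x‖ ^ p := by
  funext x
  simp only [kIntegrand, wt, norm_mul, Real.norm_eq_abs,
    abs_of_nonneg (Real.rpow_nonneg (rho_nonneg (ℓ := ℓ) x) _)]
  rfl

/-- integrability of the integrand is membership of the weighted function in `L^p` -/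
lemma integrable_kIntegrand_iff {d ℓ : ℕ} (hl : ℓ < d) {a p : ℝ} (hp : 0 < p) {α : Fin d → ℕ}
    {v : Ed d → ℝ} (hv : AEStronglyMeasurable v volume) :
    IntegrableOn (kIntegrand d (rhoModel d ℓ) a p α v) (ModelDomain d ℓ) volume ↔
      eLpNorm (wt d ℓ (ordR α - a) v) (ENNReal.ofReal p) volume < ⊤ := by
  rw [IntegrableOn, restrict_ModelDomain hl, kIntegrand_eq]
  have h := integrable_norm_rpow_iff (μ := (volume : Measure (Ed d)))
    (wt_aesm (ℓ := ℓ) (ordR α - a) hv) (p := ENNReal.ofReal p) (by simpa using hp) (by simp)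
  rw [ENNReal.toReal_ofReal hp.le] at h
  rw [h]
  exact ⟨fun h => h.2, fun h' => ⟨wt_aesm _ hv, h'⟩⟩

lemma kI_nonneg {d ℓ : ℕ} (a p : ℝ) (α : Fin d → ℕ) (v : Ed d → ℝ) :
    0 ≤ ∫ x in ModelDomain d ℓ, kIntegrand d (rhoModel d ℓ) a p α v x := by
  rw [kIntegrand_eq]
  exact integral_nonneg fun x => by positivity

lemma eLpNorm_eq_kI {d ℓ : ℕ} (hl : ℓ < d) {a p : ℝ} (hp : 0 < p) {α : Fin d → ℕ}
    {v : Ed d → ℝ} (hv : AEStronglyMeasurable v volume)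
    (h : eLpNorm (wt d ℓ (ordR α - a) v) (ENNReal.ofReal p) volume < ⊤) :
    eLpNorm (wt d ℓ (ordR α - a) v) (ENNReal.ofReal p) volume =
      ENNReal.ofReal ((∫ x in ModelDomain d ℓ, kIntegrand d (rhoModel d ℓ) a p α v x) ^ (1 / p)) := by
  have hm : MemLp (wt d ℓ (ordR α - a) v) (ENNReal.ofReal p) volume := ⟨wt_aesm _ hv, h⟩
  rw [hm.eLpNorm_eq_integral_rpow_norm (by simpa using hp) (by simp), restrict_ModelDomain hl,
    kIntegrand_eq, ENNReal.toReal_ofReal hp.le, one_div]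

lemma KnormP_nonneg {d ℓ m : ℕ} (a p : ℝ) (D : (Fin d → ℕ) → Ed d → ℝ) :
    0 ≤ KnormP d (ModelDomain d ℓ) (rhoModel d ℓ) m a p D :=
  Real.rpow_nonneg (Finset.sum_nonneg fun α _ => kI_nonneg a p α (D α)) _

lemma KN_le {d ℓ m : ℕ} (hl : ℓ < d) {a p : ℝ} (hp : 0 < p) {u : Ed d → ℝ}
    {D : (Fin d → ℕ) → Ed d → ℝ}
    (h : KMemData d (ModelDomain d ℓ) (rhoModel d ℓ) m a p u D) :
    KN d ℓ m a p D ≤ ENNReal.ofReal ((multiIdx d m).card *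
      KnormP d (ModelDomain d ℓ) (rhoModel d ℓ) m a p D) := by
  rw [ENNReal.ofReal_mul (by positivity), ENNReal.ofReal_natCast, KN]
  rw [← nsmul_eq_mul]
  refine Finset.sum_le_card_nsmul _ _ _ fun α hα => ?_
  have hv := locInt_aesm hl (h.1 α hα).2.1
  rw [eLpNorm_eq_kI hl hp hv ((integrable_kIntegrand_iff hl hp hv).1 (h.2 α hα))]
  apply ENNReal.ofReal_le_ofReal
  unfold KnormP
  apply Real.rpow_le_rpow (kI_nonneg a p α (D α)) _ (by positivity)
  exact Finset.single_le_sum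
    (f := fun α => ∫ x in ModelDomain d ℓ, kIntegrand d (rhoModel d ℓ) a p α (D α) x)
    (fun α _ => kI_nonneg a p α (D α)) hα

lemma KnormP_le {d ℓ m : ℕ} (hl : ℓ < d) {a p : ℝ} (hp : 0 < p)
    {D : (Fin d → ℕ) → Ed d → ℝ} (hm : ∀ α ∈ multiIdx d m, AEStronglyMeasurable (D α) volume)
    {B : ℝ} (hB : 0 ≤ B) (h : ∀ α ∈ multiIdx d m,
      eLpNorm (wt d ℓ (ordR α - a) (D α)) (ENNReal.ofReal p) volume ≤ ENNReal.ofReal B) :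
    KnormP d (ModelDomain d ℓ) (rhoModel d ℓ) m a p D ≤ ((multiIdx d m).card : ℝ) ^ (1 / p) * B := by
  have h1 : ∀ α ∈ multiIdx d m,
      ∫ x in ModelDomain d ℓ, kIntegrand d (rhoModel d ℓ) a p α (D α) x ≤ B ^ p := by
    intro α hα
    have h2 := h α hα
    rw [eLpNorm_eq_kI hl hp (hm α hα) (h2.trans_lt ENNReal.ofReal_lt_top),
      ENNReal.ofReal_le_ofReal_iff hB, one_div] at h2
    exact (Real.rpow_inv_le_iff_of_pos (kI_nonneg a p α (D α)) hB hp).1 h2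
  unfold KnormP
  calc _ ≤ ((multiIdx d m).card * B ^ p) ^ (1 / p) := by
        apply Real.rpow_le_rpow (Finset.sum_nonneg fun α _ => kI_nonneg a p α (D α)) _ (by positivity)
        rw [← nsmul_eq_mul]
        exact Finset.sum_le_card_nsmul _ _ _ h1
    _ = _ := by
        rw [Real.mul_rpow (by positivity) (by positivity), ← Real.rpow_mul hB,
          mul_one_div_cancel hp.ne', Real.rpow_one]

/-- Proposition `mult113`: for `1 < p < ∞`, `d/p ≤ m₀ + m₁`, `m₀, m₁ < d/p`,
`m₂ ≤ m₀ + m₁ - d/p` and `a₂ = a₀ + a₁ - d/p` there is a constant `c` with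
`‖u·v|𝒦^{m₂}_{a₂,p}‖ ≤ c ‖u|𝒦^{m₀}_{a₀,p}‖ ‖v|𝒦^{m₁}_{a₁,p}‖` in the model case. -/
theorem statement14 (d ℓ m₀ m₁ m₂ : ℕ) (hd : 2 ≤ d) (hl : ℓ < d)
    (hm₀ : 1 ≤ m₀) (hm₁ : 1 ≤ m₁) (a₀ a₁ p : ℝ) (hp : 1 < p)
    (h1 : (d : ℝ) / p ≤ m₀ + m₁) (h2 : (m₀ : ℝ) < d / p) (h3 : (m₁ : ℝ) < d / p)
    (h4 : (m₂ : ℝ) ≤ m₀ + m₁ - d / p) :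
    ∃ c : ℝ, 0 < c ∧ ∀ u v : Ed d → ℝ,
      MemKM d ℓ m₀ a₀ p u → MemKM d ℓ m₁ a₁ p v →
      MemKM d ℓ m₂ (a₀ + a₁ - d / p) p (u * v) ∧
      KnormM d ℓ m₂ (a₀ + a₁ - d / p) p (u * v) ≤
        c * KnormM d ℓ m₀ a₀ p u * KnormM d ℓ m₁ a₁ p v := by
  have hp0 : 0 < p := by linarith
  have hleib : ∀ α : Fin d → ℕ, ∃ L : List ((Fin d → ℕ) × (Fin d → ℕ)), ∃ C : ℝ≥0,
      ∑ i, α i ≤ m₂ →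
      ∀ (u v : Ed d → ℝ) (D E : (Fin d → ℕ) → Ed d → ℝ),
      IsWeakDerivFamily d (ModelDomain d ℓ) m₀ u D → KN d ℓ m₀ a₀ p D < ⊤ →
      IsWeakDerivFamily d (ModelDomain d ℓ) m₁ v E → KN d ℓ m₁ a₁ p E < ⊤ →
      HasWeakDerivOn d (ModelDomain d ℓ) α (u * v) (lsum L D E) ∧
      eLpNorm (wt d ℓ (ordR α - (a₀ + a₁ - d / p)) (lsum L D E))
        (ENNReal.ofReal p) volume ≤ C * (KN d ℓ m₀ a₀ p D * KN d ℓ m₁ a₁ p E) := by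
    intro α
    by_cases hα : ∑ i, α i ≤ m₂
    · obtain ⟨L, hL, hW⟩ := leib hl hp h2 h3 h4 (a₀ := a₀) (a₁ := a₁) _ α rfl hα
      obtain ⟨C, hC⟩ := list_bound hl a₀ a₁ hp h2 h3 h4 (r := ordR α)
        (by unfold ordR; exact_mod_cast hα) L hL
      exact ⟨L, C, fun _ u v D E hD hN hE hN' =>
        ⟨hW u v D E hD hN hE hN', (hC u v D E hD hE).2⟩⟩
    · exact ⟨[], 0, fun h => absurd h hα⟩
  choose L C hLC using hleib
  set Cs : ℝ≥0 := ∑ α ∈ multiIdx d m₂, C α with hCs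
  set n₀ : ℝ := ((multiIdx d m₀).card : ℝ) with hn₀
  set n₁ : ℝ := ((multiIdx d m₁).card : ℝ) with hn₁
  set n₂ : ℝ := ((multiIdx d m₂).card : ℝ) ^ (1 / p) with hn₂
  have hn0' : 0 ≤ n₀ := by positivity
  have hn1' : 0 ≤ n₁ := by positivity
  have hn2' : 0 ≤ n₂ := by positivity
  refine ⟨n₂ * (Cs * (n₀ * n₁)) + 1, by positivity, fun u v hu hv => ?_⟩
  have hD := hu.choose_spec
  have hE := hv.choose_spec
  have eu : KnormM d ℓ m₀ a₀ p u = KnormP d (ModelDomain d ℓ) (rhoModel d ℓ) m₀ a₀ p hu.choose := by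
    unfold KnormM Knorm
    exact dif_pos hu
  have ev : KnormM d ℓ m₁ a₁ p v = KnormP d (ModelDomain d ℓ) (rhoModel d ℓ) m₁ a₁ p hv.choose := by
    unfold KnormM Knorm
    exact dif_pos hv
  rw [eu, ev]
  set D := hu.choose
  set E := hv.choose
  set U := KnormP d (ModelDomain d ℓ) (rhoModel d ℓ) m₀ a₀ p D with hU
  set V := KnormP d (ModelDomain d ℓ) (rhoModel d ℓ) m₁ a₁ p E with hV
  have hU0 : 0 ≤ U := KnormP_nonneg _ _ _
  have hV0 : 0 ≤ V := KnormP_nonneg _ _ _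
  have hNu := KN_le hl hp0 hD
  have hNv := KN_le hl hp0 hE
  have hNu' := hNu.trans_lt ENNReal.ofReal_lt_top
  have hNv' := hNv.trans_lt ENNReal.ofReal_lt_top
  set B : ℝ := Cs * (n₀ * U * (n₁ * V)) with hB
  have hB0 : 0 ≤ B := by positivity
  have hmain : ∀ α ∈ multiIdx d m₂,
      HasWeakDerivOn d (ModelDomain d ℓ) α (u * v) (lsum (L α) D E) ∧
      eLpNorm (wt d ℓ (ordR α - (a₀ + a₁ - d / p)) (lsum (L α) D E))
        (ENNReal.ofReal p) volume ≤ ENNReal.ofReal B := by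
    intro α hα
    obtain ⟨k1, k2⟩ := hLC α (mem_multiIdx.1 hα) u v D E hD.1 hNu' hE.1 hNv'
    refine ⟨k1, k2.trans ?_⟩
    have hCα : C α ≤ Cs := Finset.single_le_sum (fun _ _ => zero_le) hα
    calc (C α : ℝ≥0∞) * (KN d ℓ m₀ a₀ p D * KN d ℓ m₁ a₁ p E)
        ≤ (Cs : ℝ≥0∞) * (ENNReal.ofReal (n₀ * U) * ENNReal.ofReal (n₁ * V)) := by
          gcongr
      _ = ENNReal.ofReal B := by
          rw [hB, ← ENNReal.ofReal_mul (by positivity), ← ENNReal.ofReal_coe_nnreal,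
            ← ENNReal.ofReal_mul (by positivity)]
  have hmem : MemKM d ℓ m₂ (a₀ + a₁ - d / p) p (u * v) := by
    refine ⟨fun α => lsum (L α) D E, fun α hα => (hmain α hα).1, fun α hα => ?_⟩
    rw [integrable_kIntegrand_iff hl hp0 (locInt_aesm hl (hmain α hα).1.2.1)]
    exact (hmain α hα).2.trans_lt ENNReal.ofReal_lt_top
  refine ⟨hmem, ?_⟩
  have hW := hmem.choose_spec
  have ew : KnormM d ℓ m₂ (a₀ + a₁ - d / p) p (u * v)
      = KnormP d (ModelDomain d ℓ) (rhoModel d ℓ) m₂ (a₀ + a₁ - d / p) p hmem.choose := by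
    unfold KnormM Knorm
    exact dif_pos hmem
  rw [ew]
  set W := hmem.choose
  have hle := KnormP_le hl hp0 (a := a₀ + a₁ - d / p) (D := W) (m := m₂)
    (fun α hα => locInt_aesm hl (hW.1 α hα).2.1) hB0 (fun α hα => by
      refine le_trans (le_of_eq ?_) (hmain α hα).2
      apply eLpNorm_congr_ae
      filter_upwards [weakDeriv_unique (isOpen_ModelDomain d ℓ) (hW.1 α hα) (hmain α hα).1,
        ae_mem_ModelDomain hl] with x hx hx'
      simp only [wt, hx hx'])
  refine hle.trans ?_
  have hUV : 0 ≤ U * V := by positivity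
  calc n₂ * B = n₂ * (Cs * (n₀ * n₁)) * (U * V) := by rw [hB]; ring
    _ ≤ (n₂ * (Cs * (n₀ * n₁)) + 1) * (U * V) := by gcongr; linarith
    _ = _ := by ring

end
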